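/- Let 𝔤₁ and 𝔤₂ be finite-dimensional real semisimple Lie algebras that are split, i.e., each admits a Cartan involution θᵢ with (−1)-eigenspace 𝔭ᵢ and a maximal abelian subspace 𝔞ᵢ ⊆ 𝔭ᵢ whose centralizer in 𝔤ᵢ equals 𝔞ᵢ. Let 𝔫ᵢ = ⊕_{λ∈Σᵢ⁺} (𝔤ᵢ)_λ be the nilpotent Iwasawa part determined by a choice of positive restricted roots. If 𝔫₁ and 𝔫₂ are isomorphic as real Lie algebras, then 𝔤₁ and 𝔤₂ are isomorphic as real Lie algebras. -/

import Mathlib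

noncomputable section

variable {g : Type*} [LieRing g] [LieAlgebra ℝ g]

/-- A Cartan involution of a real Lie algebra: an involutive automorphism `θ` such that
`(X, Y) ↦ -κ(X, θ Y)` is positive definite, where `κ` is the Killing form. -/
def IsCartanInvolution (θ : g ≃ₗ⁅ℝ⁆ g) : Prop :=
  (∀ x, θ (θ x) = x) ∧ ∀ x : g, x ≠ 0 → 0 < -(killingForm ℝ g x (θ x))

/-- The restricted root space of a linear functional `l` on the subspace `a`:
`𝔤_l = {x ∈ 𝔤 | [H, x] = l(H) • x for all H ∈ 𝔞}`. -/
def restrictedRootSpace (a : Submodule ℝ g) (l : Module.Dual ℝ a) : Submodule ℝ g where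
  carrier := {x | ∀ h : a, ⁅(h : g), x⁆ = l h • x}
  add_mem' := by
    intro x y hx hy h
    rw [lie_add, hx h, hy h, smul_add]
  zero_mem' := by intro h; simp
  smul_mem' := by
    intro c x hx h
    rw [lie_smul, hx h, smul_comm]

/-- `a` is a maximal abelian subspace of the `(-1)`-eigenspace `𝔭` of `θ`. -/
def IsMaxAbelianInP (θ : g ≃ₗ⁅ℝ⁆ g) (a : Submodule ℝ g) : Prop :=
  (∀ x ∈ a, θ x = -x) ∧ (∀ x ∈ a, ∀ y ∈ a, ⁅x, y⁆ = 0) ∧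
    ∀ a' : Submodule ℝ g, (∀ x ∈ a', θ x = -x) → (∀ x ∈ a', ∀ y ∈ a', ⁅x, y⁆ = 0) →
      a ≤ a' → a' = a

/-- The set of restricted roots of `a`: nonzero functionals with nonzero root space. -/
def restrictedRoots (a : Submodule ℝ g) : Set (Module.Dual ℝ a) :=
  {l | l ≠ 0 ∧ restrictedRootSpace a l ≠ ⊥}

/-- `H₀` is a regular element of `a`: no restricted root vanishes on it. -/
def IsRegularElt (a : Submodule ℝ g) (H₀ : a) : Prop :=
  ∀ l ∈ restrictedRoots a, l H₀ ≠ 0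

/-- The positive restricted roots `Σ⁺` determined by the regular element `H₀`. -/
def posRestrictedRoots (a : Submodule ℝ g) (H₀ : a) : Set (Module.Dual ℝ a) :=
  {l ∈ restrictedRoots a | 0 < l H₀}

/-- The nilpotent Iwasawa part `𝔫 = ⊕_{λ ∈ Σ⁺} 𝔤_λ`. -/
def iwasawaNilpart (a : Submodule ℝ g) (H₀ : a) : Submodule ℝ g :=
  ⨆ l ∈ posRestrictedRoots a H₀, restrictedRootSpace a l

/-- `𝔤` is of non-compact type (relative to the Cartan involution `θ`): no nonzero Lie ideal
is contained in the fixed-point subalgebra `𝔨` of `θ`. -/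
def IsNoncompactType (θ : g ≃ₗ⁅ℝ⁆ g) : Prop :=
  ∀ I : LieIdeal ℝ g, (∀ x ∈ I, θ x = x) → I = ⊥

/-- `s` is an Iwasawa subalgebra of the non-compact type semisimple algebra `g`, i.e.
`s = 𝔞 ⊕ 𝔫` for some Cartan involution `θ`, maximal abelian subspace `𝔞` of `𝔭`, and
choice of positivity (with `𝔤` of non-compact type relative to `θ`). -/
def IsIwasawaSubalgebraNC (s : LieSubalgebra ℝ g) : Prop :=
  ∃ (θ : g ≃ₗ⁅ℝ⁆ g) (a : Submodule ℝ g) (H₀ : a),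
    IsCartanInvolution θ ∧ IsMaxAbelianInP θ a ∧ IsRegularElt a H₀ ∧ IsNoncompactType θ ∧
      (s : Submodule ℝ g) = a ⊔ iwasawaNilpart a H₀

open Module Module.End in
/-- Data on a Lie algebra modelled on the span of the positive root spaces of a split semisimple
Lie algebra: generators `e`, a dual family `c` modulo brackets, and gradings given by derivations
with natural eigenvalues. -/
structure NilpotentFrame (n : Type*) [LieRing n] [LieAlgebra ℝ n]
    (ι : Type*) [DecidableEq ι] where
  e : ι → n
  c : ι → Module.Dual ℝ n
  deriv : ι → LieDerivation ℝ n n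
  height : LieDerivation ℝ n n
  c_e : ∀ i j, c i (e j) = if i = j then 1 else 0
  c_lie : ∀ i (x y : n), c i ⁅x, y⁆ = 0
  mem_span_lie : ∀ x, (∀ i, c i x = 0) → x ∈ Submodule.span ℝ {z | ∃ x y : n, ⁅x, y⁆ = z}
  deriv_e : ∀ i j, deriv i (e j) = if i = j then e j else 0
  iSup_deriv : ∀ i, ⨆ m : ℕ, eigenspace (deriv i).toLinearMap (m : ℝ) = ⊤
  height_e : ∀ i, height (e i) = e i
  iSup_height : ⨆ m : ℕ, eigenspace height.toLinearMap ((m : ℝ) + 1) = ⊤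

namespace NilpotentFrame

open Module Module.End Polynomial

section Aux

variable {n : Type*} [LieRing n] [LieAlgebra ℝ n]

lemma eigenspace_eq_bot_of_notMem_range {V : Type*} [AddCommGroup V] [Module ℝ V]
    (f : Module.End ℝ V) (hf : ⨆ m : ℕ, eigenspace f (m : ℝ) = ⊤) {r : ℝ}
    (hr : ∀ m : ℕ, (m : ℝ) ≠ r) : eigenspace f r = ⊥ := by
  have h1 := (eigenspaces_iSupIndep f) r
  have h2 : ⨆ j, ⨆ (_ : j ≠ r), eigenspace f j = ⊤ := by
    rw [eq_top_iff, ← hf]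
    exact iSup_le fun m ↦ le_iSup₂_of_le (m : ℝ) (hr m) le_rfl
  rw [h2] at h1
  exact disjoint_top.mp h1

lemma aeval_ad_apply (D D' : LieDerivation ℝ n n) {m : ℝ} {x : n} (hx : D x = m • x)
    (P : ℝ[X]) :
    (aeval (LieAlgebra.ad ℝ (LieDerivation ℝ n n) D) P D') x =
      aeval (D.toLinearMap - algebraMap ℝ (Module.End ℝ n) m) P (D' x) := by
  induction P using Polynomial.induction_on' generalizing D' with
  | add p q hp hq => simp [hp, hq]
  | monomial k a =>
    simp only [aeval_monomial, Module.End.mul_apply, Module.algebraMap_end_apply,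
      LieDerivation.smul_apply]
    congr 1
    induction k generalizing D' with
    | zero => simp
    | succ k ih =>
      rw [pow_succ, pow_succ, Module.End.mul_apply, Module.End.mul_apply, ih]
      congr 1
      simp [hx]

lemma aeval_sub_apply_of_mem_eigenspace {V : Type*} [AddCommGroup V] [Module ℝ V]
    {f : Module.End ℝ V} {m r : ℝ} {y : V} (hy : y ∈ eigenspace f r) (P : ℝ[X]) :
    aeval (f - algebraMap ℝ (Module.End ℝ V) m) P y = P.eval (r - m) • y := by
  rw [mem_eigenspace_iff] at hy
  induction P using Polynomial.induction_on' with
  | add p q hp hq => simp [hp, hq, add_smul]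
  | monomial k a =>
    simp only [aeval_monomial, Module.End.mul_apply, Module.algebraMap_end_apply, eval_monomial,
      mul_smul]
    congr 1
    induction k with
    | zero => simp
    | succ k ih =>
      rw [pow_succ, Module.End.mul_apply]
      simp only [LinearMap.sub_apply, hy, Module.algebraMap_end_apply, ← sub_smul, map_smul, ih,
        smul_smul]
      ring_nf

/-- A polynomial selecting the degree `-1` component of a derivation. -/
lemma exists_polynomial_lowering {V : Type*} [AddCommGroup V] [Module ℝ V] [Module.Finite ℝ V]
    (f : Module.End ℝ V) :
    ∃ P : ℝ[X], P.eval (-1) = 1 ∧ P.eval 0 = 0 ∧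
      ∀ r m, f.HasEigenvalue r → f.HasEigenvalue m → ((X + 1) * P).eval (r - m) = 0 := by
  classical
  let T := (finite_hasEigenvalue f).toFinset
  let S : Finset ℝ := insert (-1) (insert 0 (Finset.image₂ (· - ·) T T))
  refine ⟨Lagrange.basis S id (-1), ?_, ?_, ?_⟩
  · exact Lagrange.eval_basis_self (v := id) (Set.injOn_id _) (by simp [S])
  · exact Lagrange.eval_basis_of_ne (v := id) (i := (-1 : ℝ)) (j := 0) (by norm_num) (by simp [S])
  · intro r m hr hm
    by_cases h : r - m = -1
    · simp [h]
    · have := Lagrange.eval_basis_of_ne (s := S) (v := id) (i := (-1 : ℝ)) (j := r - m)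
        (Ne.symm h) (by
          simp only [S, Finset.mem_insert]
          exact .inr (.inr (Finset.mem_image₂_of_mem (by simpa [T] using hr)
            (by simpa [T] using hm))))
      rw [eval_mul]
      simp only [id] at this
      rw [this, mul_zero]

end Aux

variable {n : Type*} [LieRing n] [LieAlgebra ℝ n]
  {ι : Type*} [DecidableEq ι] (F : NilpotentFrame n ι)

lemma c_apply_eq_zero_of_forall (D : LieDerivation ℝ n n) {x : n} (hx : ∀ i, F.c i x = 0) (k : ι) :
    F.c k (D x) = 0 := by
  have := F.mem_span_lie x hx
  clear hx
  induction this using Submodule.span_induction with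
  | mem x h => obtain ⟨y, z, rfl⟩ := h; simp [F.c_lie]
  | zero => simp
  | add x y _ _ hx hy => simp [hx, hy]
  | smul a x _ hx => simp [hx]

lemma map_c_eq_zero_of_forall {n' ι' : Type*} [LieRing n'] [LieAlgebra ℝ n'] [DecidableEq ι']
    (F' : NilpotentFrame n' ι') (φ : n →ₗ⁅ℝ⁆ n') {x : n} (hx : ∀ i, F.c i x = 0) (k : ι') :
    F'.c k (φ x) = 0 := by
  have := F.mem_span_lie x hx
  clear hx
  induction this using Submodule.span_induction with
  | mem x h => obtain ⟨y, z, rfl⟩ := h; simp [F'.c_lie]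
  | zero => simp
  | add x y _ _ hx hy => simp [hx, hy]
  | smul a x _ hx => simp [hx]

lemma c_sub_sum [Fintype ι] (x : n) (i : ι) : F.c i (x - ∑ j, F.c j x • F.e j) = 0 := by
  simp [F.c_e]

lemma c_deriv_apply [Fintype ι] (D : LieDerivation ℝ n n) (x : n) (k : ι) :
    F.c k (D x) = ∑ i, F.c i x * F.c k (D (F.e i)) := by
  have := F.c_apply_eq_zero_of_forall D (F.c_sub_sum x) k
  simpa [sub_eq_zero] using this

lemma c_map_apply [Fintype ι] {n' ι' : Type*} [LieRing n'] [LieAlgebra ℝ n'] [DecidableEq ι']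
    (F' : NilpotentFrame n' ι') (φ : n →ₗ⁅ℝ⁆ n') (x : n) (k : ι') :
    F'.c k (φ x) = ∑ i, F.c i x * F'.c k (φ (F.e i)) := by
  have := F.map_c_eq_zero_of_forall F' φ (F.c_sub_sum x) k
  simpa [sub_eq_zero] using this

lemma c_deriv_frame [Fintype ι] (p k : ι) (x : n) :
    F.c k (F.deriv p x) = (if k = p then 1 else 0) * F.c k x := by
  rw [c_deriv_apply]
  by_cases h : k = p
  · subst h
    simp [F.deriv_e, apply_ite, F.c_e]
  · simp [F.deriv_e, apply_ite, F.c_e, h]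

/-- The degree `-1` component of a derivation with respect to the grading by `F.deriv p`. -/
lemma exists_lowering_deriv [Fintype ι] [Module.Finite ℝ n] (D : LieDerivation ℝ n n) (p : ι) :
    ∃ E : LieDerivation ℝ n n, IsNilpotent E.toLinearMap ∧ (∀ q, q ≠ p → E (F.e q) = 0) ∧
      ∀ k, F.c k (E (F.e p)) = if k = p then 0 else F.c k (D (F.e p)) := by
  obtain ⟨P, hP1, hP0, hP⟩ := exists_polynomial_lowering (F.deriv p).toLinearMap
  set f := (F.deriv p).toLinearMap with hf
  set E := aeval (LieAlgebra.ad ℝ (LieDerivation ℝ n n) (F.deriv p)) P D with hE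
  have hbot (r : ℝ) (hr : ∀ m : ℕ, (m : ℝ) ≠ r) : eigenspace f r = ⊥ :=
    eigenspace_eq_bot_of_notMem_range f (F.iSup_deriv p) hr
  have hEm (m : ℝ) (x : n) (hx : x ∈ eigenspace f m) : E x ∈ eigenspace f (m - 1) := by
    by_cases hx0 : x = 0
    · simp [hx0]
    have hm : HasEigenvalue f m := hasEigenvalue_of_hasEigenvector ⟨hx, hx0⟩
    have key : ∀ y, aeval (f - algebraMap ℝ (Module.End ℝ n) m) ((X + 1) * P) y = 0 := by
      intro y
      have hy : y ∈ ⨆ m : ℕ, eigenspace f (m : ℝ) := by rw [F.iSup_deriv p]; trivial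
      induction hy using Submodule.iSup_induction' with
      | mem r y hy =>
        by_cases hy0 : y = 0
        · simp [hy0]
        rw [aeval_sub_apply_of_mem_eigenspace hy,
          hP r m (hasEigenvalue_of_hasEigenvector ⟨hy, hy0⟩) hm, zero_smul]
      | zero => simp
      | add y z _ _ hy hz => rw [map_add, hy, hz, add_zero]
    have h1 := key (D x)
    rw [map_mul, Module.End.mul_apply, hf, ← aeval_ad_apply (F.deriv p) D
      (by simpa [hf] using mem_eigenspace_iff.mp hx) P] at h1
    rw [mem_eigenspace_iff]
    simp only [map_add, aeval_X, map_one, LinearMap.add_apply, LinearMap.sub_apply,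
      Module.algebraMap_end_apply, Module.End.one_apply] at h1
    rw [sub_smul, one_smul, ← sub_eq_zero, ← h1]
    simp only [hf, hE]
    abel
  have hneg (x : n) (hx : x ∈ eigenspace f (-1)) : x = 0 := by
    rw [hbot (-1) (fun m h ↦ by have : (0 : ℝ) ≤ m := m.cast_nonneg; linarith)] at hx
    simpa using hx
  have hEpow (k : ℕ) (m : ℝ) (x : n) (hx : x ∈ eigenspace f m) :
      (E.toLinearMap ^ k) x ∈ eigenspace f (m - k) := by
    induction k with
    | zero => simpa using hx
    | succ k ih =>
      rw [pow_succ', Module.End.mul_apply]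
      have := hEm _ _ ih
      push_cast
      rwa [← sub_sub]
  refine ⟨E, ?_, ?_, ?_⟩
  · rw [Module.End.isNilpotent_iff_of_finite]
    intro x
    have hx : x ∈ ⨆ m : ℕ, eigenspace f (m : ℝ) := by rw [F.iSup_deriv p]; trivial
    induction hx using Submodule.iSup_induction' with
    | mem m x hx =>
      refine ⟨m + 1, hneg _ ?_⟩
      have := hEpow (m + 1) m x hx
      push_cast at this
      rwa [sub_add_cancel_left] at this
    | zero => exact ⟨0, by simp⟩
    | add x y _ _ hx hy =>
      obtain ⟨a, ha⟩ := hx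
      obtain ⟨b, hb⟩ := hy
      refine ⟨a + b, ?_⟩
      rw [map_add]
      nth_rewrite 1 [add_comm a b]
      rw [pow_add, pow_add, Module.End.mul_apply, Module.End.mul_apply, ha, hb]
      simp
  · intro q hq
    apply hneg
    have : F.e q ∈ eigenspace f 0 := by
      rw [mem_eigenspace_iff]
      simp [hf, F.deriv_e, hq.symm]
    simpa using hEm _ _ this
  · intro k
    have hc (Q : ℝ[X]) (y : n) : F.c k (aeval (f - algebraMap ℝ (Module.End ℝ n) 1) Q y) =
        Q.eval ((if k = p then 1 else 0) - 1) * F.c k y := by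
      induction Q using Polynomial.induction_on' with
      | add p q hp hq => rw [map_add, LinearMap.add_apply, map_add, hp, hq, eval_add, add_mul]
      | monomial j a =>
        simp only [aeval_monomial, Module.End.mul_apply, Module.algebraMap_end_apply,
          eval_monomial, mul_assoc, map_smul, smul_eq_mul]
        congr 1
        induction j with
        | zero => simp
        | succ j ih =>
          rw [pow_succ', Module.End.mul_apply, LinearMap.sub_apply, map_sub, hf]
          simp only [LieDerivation.coeFn_coe, c_deriv_frame, Module.algebraMap_end_apply, one_smul]
          rw [hf] at ih
          rw [ih]
          ring
    rw [hE, aeval_ad_apply (F.deriv p) D (m := 1) (by simp [F.deriv_e]) P, ← hf, hc]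
    by_cases h : k = p
    · simp [h, hP0]
    · simp [h, hP1]

/-- An automorphism adding multiples of the `p`-th row to other rows, with coefficients read off
from a derivation. -/
lemma exists_equiv_of_deriv [Fintype ι] [Module.Finite ℝ n] (D : LieDerivation ℝ n n) (p : ι) (t : ℝ) :
    ∃ ψ : n ≃ₗ⁅ℝ⁆ n, ∀ k x,
      F.c k (ψ x) = F.c k x + t * (F.c p x * if k = p then 0 else F.c k (D (F.e p))) := by
  obtain ⟨E₀, hnil₀, hE0, hEp⟩ := F.exists_lowering_deriv D p
  obtain ⟨E, hE⟩ : ∃ E, E = t • E₀ := ⟨_, rfl⟩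
  have hnil : IsNilpotent E.toLinearMap := by
    rw [hE]
    exact hnil₀.smul t
  let : Module ℚ n := Module.compHom n (algebraMap ℚ ℝ)
  let : LieAlgebra ℚ n := { lie_smul := fun q x y ↦ lie_smul (algebraMap ℚ ℝ q) x y }
  have hc1 (k : ι) (x : n) :
      F.c k (E x) = t * (F.c p x * if k = p then 0 else F.c k (D (F.e p))) := by
    rw [c_deriv_apply, Finset.sum_eq_single p]
    · rw [hE, LieDerivation.smul_apply, map_smul, hEp, smul_eq_mul]
      ring
    · intro q _ hq
      simp [hE, hE0 q hq]
    · simp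
  have hc2 (k : ι) (x : n) : F.c k (E (E x)) = 0 := by
    rw [hc1, hc1]; simp
  refine ⟨LieDerivation.exp E hnil, fun k x ↦ ?_⟩
  obtain ⟨N, hN⟩ := id hnil
  have hN' : E.toLinearMap ^ (N + 2) = 0 := by rw [pow_add, hN, zero_mul]
  rw [LieDerivation.exp_map_apply, IsNilpotent.exp_eq_sum hN', Finset.sum_range_succ',
    Finset.sum_range_succ']
  have hz : ∀ i : ℕ, F.c k (((i.factorial : ℚ)⁻¹ • E.toLinearMap ^ i) x) =
      (i.factorial : ℝ)⁻¹ * F.c k ((E.toLinearMap ^ i) x) := by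
    intro i
    have : ((i.factorial : ℚ)⁻¹ • E.toLinearMap ^ i) x =
        (algebraMap ℚ ℝ (i.factorial : ℚ)⁻¹) • ((E.toLinearMap ^ i) x) := rfl
    rw [this, map_smul]
    simp
  simp only [LinearMap.add_apply, map_add, LinearMap.sum_apply, map_sum, hz]
  rw [Finset.sum_eq_zero]
  · simp [hc1]
    ring
  · intro i _
    rw [pow_succ', pow_succ']
    simp [hc2]

section Equiv

variable {n' ι' : Type*} [LieRing n'] [LieAlgebra ℝ n'] [DecidableEq ι']
  (F' : NilpotentFrame n' ι')

lemma sum_c_map_c_symm [Fintype ι] (φ : n ≃ₗ⁅ℝ⁆ n') (k l : ι') :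
    ∑ i, F.c i (φ.symm (F'.e l)) * F'.c k (φ (F.e i)) = if k = l then 1 else 0 := by
  have := F.c_map_apply F' φ.toLieHom (φ.symm (F'.e l)) k
  simpa [F'.c_e] using this.symm

/-- A derivation transported along an isomorphism. -/
def conjDeriv (φ : n ≃ₗ⁅ℝ⁆ n') (D : LieDerivation ℝ n n) : LieDerivation ℝ n' n' where
  toLinearMap := φ.toLinearEquiv.toLinearMap ∘ₗ D.toLinearMap ∘ₗ φ.symm.toLinearEquiv.toLinearMap
  leibniz' x y := by
    change φ (D (φ.symm ⁅x, y⁆)) = ⁅x, φ (D (φ.symm y))⁆ - ⁅y, φ (D (φ.symm x))⁆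
    rw [LieEquiv.map_lie, D.apply_lie_eq_sub, map_sub, LieEquiv.map_lie, LieEquiv.map_lie,
      LieEquiv.apply_symm_apply, LieEquiv.apply_symm_apply]

lemma conjDeriv_apply (φ : n ≃ₗ⁅ℝ⁆ n') (D : LieDerivation ℝ n n) (x : n') :
    conjDeriv φ D x = φ (D (φ.symm x)) := rfl

/-- Any isomorphism can be corrected by automorphisms so that it permutes, up to scalars, the
generators indexed by a given finite set modulo brackets. -/
lemma exists_equiv_monomial_on [Fintype ι] [Fintype ι'] [Module.Finite ℝ n'] (φ₀ : n ≃ₗ⁅ℝ⁆ n') (S : Finset ι) :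
    ∃ (φ : n ≃ₗ⁅ℝ⁆ n') (σ : ι → ι'), ∀ i ∈ S, ∀ k, k ≠ σ i → F'.c k (φ (F.e i)) = 0 := by
  induction S using Finset.induction_on with
  | empty =>
    by_cases h : Nonempty ι'
    · exact ⟨φ₀, fun _ ↦ h.some, by simp⟩
    · by_cases h' : Nonempty ι
      · obtain ⟨i⟩ := h'
        have := F'.sum_c_map_c_symm F φ₀.symm i i
        rw [not_nonempty_iff] at h
        simp at this
      · rw [not_nonempty_iff] at h'
        exact ⟨φ₀, fun i ↦ h'.elim i, by simp⟩
  | insert j S hj ih =>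
    obtain ⟨φ, σ, hσ⟩ := ih
    have hinv (i l : ι) := F'.sum_c_map_c_symm F φ.symm i l
    simp only [LieEquiv.symm_symm] at hinv
    have hS (i : ι) (hi : i ∈ S) (l : ι) :
        F'.c (σ i) (φ (F.e i)) * F.c l (φ.symm (F'.e (σ i))) = if l = i then 1 else 0 := by
      rw [← hinv l i, Finset.sum_eq_single (σ i)]
      · intro k _ hk
        rw [hσ i hi k hk, zero_mul]
      · simp
    obtain ⟨p, -, hp⟩ : ∃ p ∈ Finset.univ, F'.c p (φ (F.e j)) * F.c j (φ.symm (F'.e p)) ≠ 0 := by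
      apply Finset.exists_ne_zero_of_sum_ne_zero
      rw [hinv j j]
      simp
    have hpS (i : ι) (hi : i ∈ S) : p ≠ σ i := by
      rintro rfl
      have h1 := hS i hi j
      rw [if_neg (by rintro rfl; exact hj hi)] at h1
      have h2 := hS i hi i
      rw [if_pos rfl] at h2
      rcases mul_eq_zero.mp h1 with h | h
      · rw [h, zero_mul] at h2
        exact zero_ne_one h2
      · exact hp (by rw [h, mul_zero])
    obtain ⟨s, hs⟩ : ∃ s, s = F'.c p (φ (F.e j)) * F.c j (φ.symm (F'.e p)) := ⟨_, rfl⟩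
    rw [← hs] at hp
    obtain ⟨ψ, hψ⟩ := F'.exists_equiv_of_deriv (conjDeriv φ (F.deriv j)) p (-s⁻¹)
    refine ⟨φ.trans ψ, Function.update σ j p, fun i hi k hk ↦ ?_⟩
    rw [LieEquiv.trans_apply, hψ]
    rcases Finset.mem_insert.mp hi with rfl | hiS
    · rw [Function.update_self] at hk
      have hD : F'.c k (conjDeriv φ (F.deriv i) (F'.e p)) =
          F.c i (φ.symm (F'.e p)) * F'.c k (φ (F.e i)) := by
        rw [conjDeriv_apply]
        have := F.c_map_apply F' φ.toLieHom (F.deriv i (φ.symm (F'.e p))) k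
        simpa [c_deriv_frame] using this
      rw [if_neg hk, hD, ← mul_assoc (F'.c p _), ← hs]
      field_simp
      ring
    · have hij : i ≠ j := by rintro rfl; exact hj hiS
      rw [Function.update_of_ne hij] at hk
      rw [hσ i hiS k hk, hσ i hiS p (hpS i hiS)]
      simp

lemma exists_equiv_monomial [Fintype ι] [Fintype ι'] [Module.Finite ℝ n'] (φ₀ : n ≃ₗ⁅ℝ⁆ n') :
    ∃ (φ : n ≃ₗ⁅ℝ⁆ n') (σ : ι ≃ ι'), (∀ i k, k ≠ σ i → F'.c k (φ (F.e i)) = 0) ∧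
      (∀ i k, k ≠ i → F.c k (φ.symm (F'.e (σ i))) = 0) ∧
      (∀ i, F'.c (σ i) (φ (F.e i)) ≠ 0) ∧ ∀ i, F.c i (φ.symm (F'.e (σ i))) ≠ 0 := by
  obtain ⟨φ, σ, hσ⟩ := F.exists_equiv_monomial_on F' φ₀ Finset.univ
  replace hσ (i : ι) (k : ι') (hk : k ≠ σ i) := hσ i (Finset.mem_univ i) k hk
  have hS (i l : ι) :
      F'.c (σ i) (φ (F.e i)) * F.c l (φ.symm (F'.e (σ i))) = if l = i then 1 else 0 := by
    have hinv := F'.sum_c_map_c_symm F φ.symm l i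
    simp only [LieEquiv.symm_symm] at hinv
    rw [← hinv, Finset.sum_eq_single (σ i)]
    · intro k _ hk
      rw [hσ i k hk, zero_mul]
    · simp
  have h1 (i : ι) : F'.c (σ i) (φ (F.e i)) ≠ 0 := fun h ↦ by simpa [h] using hS i i
  have h2 (i : ι) : F.c i (φ.symm (F'.e (σ i))) ≠ 0 := fun h ↦ by simpa [h] using hS i i
  have h3 (i k : ι) (hk : k ≠ i) : F.c k (φ.symm (F'.e (σ i))) = 0 := by
    simpa [hk, h1] using hS i k
  have hinj : Function.Injective σ := by
    intro i j hij
    by_contra hne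
    apply h2 i
    rw [hij]
    exact h3 j i hne
  have hsurj : Function.Surjective σ := by
    intro l
    by_contra! hl
    have := F.sum_c_map_c_symm F' φ l l
    rw [Finset.sum_eq_zero (fun i _ ↦ by rw [hσ i l (hl i).symm, mul_zero])] at this
    simp at this
  exact ⟨φ, Equiv.ofBijective σ ⟨hinj, hsurj⟩, hσ, h3, h1, h2⟩

/-- The sum of the eigenspaces of height at least `r`. -/
def heightGE (r : ℕ) : Submodule ℝ n :=
  ⨆ m : ℕ, eigenspace F.height.toLinearMap ((m : ℝ) + r)

lemma mem_heightGE_of_mem_eigenspace {x : n} {m : ℕ} (r : ℕ) (hrm : r ≤ m)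
    (hx : x ∈ eigenspace F.height.toLinearMap (m : ℝ)) : x ∈ F.heightGE r := by
  refine Submodule.mem_iSup_of_mem (m - r) ?_
  rw [Nat.cast_sub hrm]
  simpa using hx

lemma heightGE_antitone {r s : ℕ} (h : r ≤ s) : F.heightGE s ≤ F.heightGE r := by
  refine iSup_le fun m x hx ↦ F.mem_heightGE_of_mem_eigenspace r (m := m + s) (by lia) ?_
  push_cast
  exact hx

lemma lie_mem_eigenspace_height {x y : n} {r s : ℝ}
    (hx : x ∈ eigenspace F.height.toLinearMap r) (hy : y ∈ eigenspace F.height.toLinearMap s) :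
    ⁅x, y⁆ ∈ eigenspace F.height.toLinearMap (r + s) := by
  rw [mem_eigenspace_iff, LieDerivation.coeFn_coe] at hx hy ⊢
  rw [LieDerivation.apply_lie_eq_add, hx, hy, lie_smul, smul_lie, ← add_smul, add_comm]

lemma lie_mem_heightGE {x y : n} {r s : ℕ} (hx : x ∈ F.heightGE r) (hy : y ∈ F.heightGE s) :
    ⁅x, y⁆ ∈ F.heightGE (r + s) := by
  induction hx using Submodule.iSup_induction' with
  | mem i x hx =>
    induction hy using Submodule.iSup_induction' with
    | mem j y hy =>
      refine F.mem_heightGE_of_mem_eigenspace (m := i + r + (j + s)) _ (by lia) ?_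
      push_cast
      exact F.lie_mem_eigenspace_height hx hy
    | zero => simp
    | add y z _ _ hy hz => rw [lie_add]; exact add_mem hy hz
  | zero => simp
  | add x z _ _ hx hz => rw [add_lie]; exact add_mem hx hz

lemma mem_heightGE_one (x : n) : x ∈ F.heightGE 1 := by
  have : F.heightGE 1 = ⊤ := by
    rw [← F.iSup_height, heightGE]
    simp
  rw [this]
  trivial

lemma mem_heightGE_two_of_forall {x : n} (hx : ∀ i, F.c i x = 0) : x ∈ F.heightGE 2 := by
  have : Submodule.span ℝ {z | ∃ x y : n, ⁅x, y⁆ = z} ≤ F.heightGE 2 := by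
    rw [Submodule.span_le]
    rintro _ ⟨y, z, rfl⟩
    have h : ⁅y, z⁆ ∈ F.heightGE (1 + 1) :=
      F.lie_mem_heightGE (F.mem_heightGE_one y) (F.mem_heightGE_one z)
    rwa [one_add_one_eq_two] at h
  exact this (F.mem_span_lie x hx)

lemma eq_zero_of_mem_heightGE {x : n} {m : ℕ} (hx : x ∈ eigenspace F.height.toLinearMap (m : ℝ))
    (hx' : x ∈ F.heightGE (m + 1)) : x = 0 := by
  have h1 := eigenspaces_iSupIndep F.height.toLinearMap (m : ℝ)
  rw [Submodule.disjoint_def] at h1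
  refine h1 x hx ?_
  refine (iSup_le fun k ↦ ?_ : F.heightGE (m + 1) ≤ _) hx'
  refine le_iSup₂_of_le ((k : ℝ) + (m + 1 : ℕ)) ?_ le_rfl
  push_cast
  have : (0 : ℝ) ≤ k := k.cast_nonneg
  linarith

lemma sub_mem_heightGE_two [Fintype ι] {x : n} {i : ι} (hx : ∀ k, k ≠ i → F.c k x = 0) :
    x - F.c i x • F.e i ∈ F.heightGE 2 := by
  apply F.mem_heightGE_two_of_forall
  intro k
  by_cases h : k = i
  · subst h; simp [F.c_e]
  · simp [F.c_e, h, hx k h]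

lemma ad_pow_mem_eigenspace (i j : ι) (m : ℕ) :
    ((LieAlgebra.ad ℝ n (F.e i)) ^ m) (F.e j) ∈
      eigenspace F.height.toLinearMap ((m + 1 : ℕ) : ℝ) := by
  induction m with
  | zero => rw [mem_eigenspace_iff]; simp [F.height_e]
  | succ m ih =>
    rw [pow_succ', Module.End.mul_apply, LieAlgebra.ad_apply]
    have h1 : F.e i ∈ eigenspace F.height.toLinearMap (1 : ℝ) := by
      rw [mem_eigenspace_iff]; simp [F.height_e]
    convert F.lie_mem_eigenspace_height h1 ih using 1
    push_cast
    ring_nf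

/-- An isomorphism which is monomial modulo brackets transports Serre type relations. -/
lemma ad_pow_eq_zero_of_monomial [Fintype ι'] (φ : n ≃ₗ⁅ℝ⁆ n') (σ : ι → ι')
    (hσ : ∀ i k, k ≠ σ i → F'.c k (φ (F.e i)) = 0)
    (hσ' : ∀ i, F'.c (σ i) (φ (F.e i)) ≠ 0) (i j : ι) (m : ℕ)
    (h : ((LieAlgebra.ad ℝ n (F.e i)) ^ m) (F.e j) = 0) :
    ((LieAlgebra.ad ℝ n' (F'.e (σ i))) ^ m) (F'.e (σ j)) = 0 := by
  set a := F'.c (σ i) (φ (F.e i)) with ha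
  set b := F'.c (σ j) (φ (F.e j)) with hb
  have key (m : ℕ) : φ (((LieAlgebra.ad ℝ n (F.e i)) ^ m) (F.e j)) -
      (a ^ m * b) • ((LieAlgebra.ad ℝ n' (F'.e (σ i))) ^ m) (F'.e (σ j)) ∈
        F'.heightGE (m + 2) := by
    induction m with
    | zero => simpa using F'.sub_mem_heightGE_two (hσ j)
    | succ m ih =>
      simp only [pow_succ' (LieAlgebra.ad _ _ _), Module.End.mul_apply, LieAlgebra.ad_apply,
        LieEquiv.map_lie]
      set u := ((LieAlgebra.ad ℝ n' (F'.e (σ i))) ^ m) (F'.e (σ j)) with hu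
      set v := φ (((LieAlgebra.ad ℝ n (F.e i)) ^ m) (F.e j)) with hv
      have h1 := F'.sub_mem_heightGE_two (hσ i)
      rw [← ha] at h1
      have hv1 : v ∈ F'.heightGE (m + 1) := by
        rw [← sub_add_cancel v ((a ^ m * b) • u)]
        refine add_mem (F'.heightGE_antitone (by lia) ih) (Submodule.smul_mem _ _ ?_)
        exact F'.mem_heightGE_of_mem_eigenspace _ le_rfl (F'.ad_pow_mem_eigenspace _ _ m)
      have h2 : ⁅φ (F.e i), v⁆ - (a ^ (m + 1) * b) • ⁅F'.e (σ i), u⁆ =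
          ⁅φ (F.e i) - a • F'.e (σ i), v⁆ + a • ⁅F'.e (σ i), v - (a ^ m * b) • u⁆ := by
        simp only [sub_lie, lie_sub, smul_lie, lie_smul, smul_sub, smul_smul]
        rw [pow_succ', mul_assoc]
        abel
      rw [h2]
      refine add_mem ?_ (Submodule.smul_mem _ _ ?_)
      · have := F'.lie_mem_heightGE h1 hv1
        convert this using 2
        ring
      · have := F'.lie_mem_heightGE (F'.mem_heightGE_one (F'.e (σ i))) ih
        convert this using 2
        ring
  have h1 := key m
  rw [h, map_zero, zero_sub, neg_mem_iff] at h1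
  rw [Submodule.smul_mem_iff _ (mul_ne_zero (pow_ne_zero _ (hσ' i)) (hσ' j))] at h1
  exact F'.eq_zero_of_mem_heightGE (F'.ad_pow_mem_eigenspace _ _ m) h1

/-- Isomorphic framed Lie algebras have the same Serre type relations up to reindexing. -/
lemma exists_equiv_ad_pow_iff [Fintype ι] [Fintype ι'] [Module.Finite ℝ n'] (φ₀ : n ≃ₗ⁅ℝ⁆ n') :
    ∃ σ : ι ≃ ι', ∀ i j m, ((LieAlgebra.ad ℝ n (F.e i)) ^ m) (F.e j) = 0 ↔
      ((LieAlgebra.ad ℝ n' (F'.e (σ i))) ^ m) (F'.e (σ j)) = 0 := by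
  obtain ⟨φ, σ, h1, h2, h3, h4⟩ := F.exists_equiv_monomial F' φ₀
  refine ⟨σ, fun i j m ↦ ⟨F.ad_pow_eq_zero_of_monomial F' φ σ h1 h3 i j m, fun h ↦ ?_⟩⟩
  have := F'.ad_pow_eq_zero_of_monomial F φ.symm σ.symm
    (fun i k hk ↦ by simpa using h2 (σ.symm i) k hk)
    (fun i ↦ by simpa using h4 (σ.symm i)) (σ i) (σ j) m h
  simpa using this

end Equiv

end NilpotentFrame

namespace LieAlgebra.Basis

open Function LieSubalgebra Set LieModule

lemma exists_mem_cartan_of_lieIdeal_ne_bot {K L : Type*} [Field K] [CharZero K] [LieRing L]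
    [LieAlgebra K L] [FiniteDimensional K L] [IsKilling K L] (H : LieSubalgebra K L)
    [H.IsCartanSubalgebra] [IsTriangularizable K H L] (I : LieIdeal K L) (hI : I ≠ ⊥) :
    ∃ y ∈ I, y ∈ H ∧ y ≠ 0 := by
  by_contra! h
  apply hI
  have h1 : I.restr H ⊓ H.toLieSubmodule = ⊥ := by
    rw [_root_.eq_bot_iff]
    rintro x ⟨hx, hxH⟩
    simpa using h x hx hxH
  have h2 := IsKilling.lieIdeal_eq_inf_cartan_sup_biSup_rootSpace (H := H) I
  rw [h1, bot_sup_eq, iSup₂_eq_bot.mpr] at h2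
  · rw [_root_.eq_bot_iff]
    intro x hx
    have : x ∈ I.restr H := hx
    rw [h2] at this
    simpa using this
  · intro α hα
    exfalso
    have h3 := I.corootSubmodule_le hα (IsKilling.coe_coroot_mem_corootSubmodule (α : Weight K H L))
    have h4 := h _ h3 (IsKilling.coroot (α : Weight K H L)).property
    have h5 : (α : Weight K H L).IsNonZero := H.isNonZero_coe_root α
    have h6 := IsKilling.root_apply_coroot h5
    simp only [ZeroMemClass.coe_eq_zero] at h4
    simp [h4] at h6

section

variable {ι K L L₁ L₂ : Type*} [Fintype ι] [Field K] [LieRing L] [LieRing L₁]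
  [LieRing L₂] [LieAlgebra K L] [LieAlgebra K L₁] [LieAlgebra K L₂]
  {H : LieSubalgebra K L} {H₁ : LieSubalgebra K L₁} {H₂ : LieSubalgebra K L₂}

/-- If `L` embeds into `L₁ × L₂` compatibly with bases and surjects onto a Killing Lie algebra
`L₂`, then the projection to `L₁` is injective. -/
lemma injective_of_disjoint_ker [CharZero K] [FiniteDimensional K L₂] [IsKilling K L₂] [H₂.IsCartanSubalgebra]
    [IsTriangularizable K H₂ L₂] (b : Basis ι H) (b₁ : Basis ι H₁) (b₂ : Basis ι H₂)
    (p : L →ₗ⁅K⁆ L₁) (q : L →ₗ⁅K⁆ L₂) (hq : Surjective q)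
    (hp : ∀ i, p (b.h i) = b₁.h i) (hq' : ∀ i, q (b.h i) = b₂.h i)
    (hpq : ∀ x, p x = 0 → q x = 0 → x = 0) : Injective p := by
  have hpH : ∀ x ∈ H, p x = 0 → x = 0 := by
    intro x hx hpx
    rw [← LieSubalgebra.mem_toSubmodule, b.coe_cartan_eq_span,
      Submodule.mem_span_range_iff_exists_fun] at hx
    obtain ⟨c, rfl⟩ := hx
    have := Fintype.linearIndependent_iff.mp b₁.linInd c (by simpa [hp] using hpx)
    simp [this]
  have hqH : ∀ x ∈ H, q x ∈ H₂ := by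
    intro x hx
    rw [← LieSubalgebra.mem_toSubmodule, b.coe_cartan_eq_span,
      Submodule.mem_span_range_iff_exists_fun] at hx
    obtain ⟨c, rfl⟩ := hx
    rw [← LieSubalgebra.mem_toSubmodule, b₂.coe_cartan_eq_span,
      Submodule.mem_span_range_iff_exists_fun]
    exact ⟨c, by simp [hq']⟩
  rw [← LieHom.ker_eq_bot]
  by_contra hne
  have hJ : p.ker.map q ≠ ⊥ := by
    rw [ne_eq, LieIdeal.map_eq_bot_iff]
    contrapose! hne
    rw [_root_.eq_bot_iff]
    intro x hx
    simpa using hpq x (by simpa using hx) (by simpa using hne hx)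
  obtain ⟨y, hyJ, hyH, hy0⟩ := exists_mem_cartan_of_lieIdeal_ne_bot H₂ _ hJ
  have hJ' : ((p.ker.map q : LieIdeal K L₂) : Set L₂) = q '' p.ker :=
    congr_arg SetLike.coe (p.ker.coe_map_of_surjective hq)
  obtain ⟨x, hx, rfl⟩ : y ∈ q '' p.ker := hJ' ▸ hyJ
  have hx : p x = 0 := by simpa using hx
  have := b.isLieAbelian_cartan
  have := b₂.isLieAbelian_cartan
  have hxH : x ∈ H := by
    rw [← LieSubalgebra.mem_toLieSubmodule, b.cartan_eq, LieModule.mem_genWeightSpace]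
    rintro ⟨u, hu⟩
    refine ⟨1, ?_⟩
    have h1 : ⁅u, x⁆ = 0 := by
      apply hpq
      · simp [hx]
      · have : ⁅(⟨q u, hqH u hu⟩ : H₂), (⟨q x, hyH⟩ : H₂)⁆ = 0 := trivial_lie_zero _ _ _ _
        simpa using congr_arg Subtype.val this
    simpa using h1
  exact hy0 (by rw [hpH x hxH hx, map_zero])

/-- The subalgebra of the product generated by pairs of corresponding generators. -/
def diag (b₁ : Basis ι H₁) (b₂ : Basis ι H₂) : LieSubalgebra K (L₁ × L₂) :=
  lieSpan K _ (range (fun i ↦ (b₁.e i, b₂.e i)) ∪ range (fun i ↦ (b₁.f i, b₂.f i)))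

/-- The pair of `i`-th raising generators. -/
abbrev diagE (b₁ : Basis ι H₁) (b₂ : Basis ι H₂) (i : ι) : diag b₁ b₂ :=
  ⟨(b₁.e i, b₂.e i), subset_lieSpan (.inl ⟨i, rfl⟩)⟩

/-- The pair of `i`-th lowering generators. -/
abbrev diagF (b₁ : Basis ι H₁) (b₂ : Basis ι H₂) (i : ι) : diag b₁ b₂ :=
  ⟨(b₁.f i, b₂.f i), subset_lieSpan (.inr ⟨i, rfl⟩)⟩

/-- The pair of `i`-th coroots. -/
abbrev diagH (b₁ : Basis ι H₁) (b₂ : Basis ι H₂) (i : ι) : diag b₁ b₂ :=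
  ⟨(b₁.h i, b₂.h i), by
    have := (diag b₁ b₂).lie_mem (diagE b₁ b₂ i).2 (diagF b₁ b₂ i).2
    simpa [(b₁.sl2 i).lie_e_f, (b₂.sl2 i).lie_e_f] using this⟩

lemma lieSpan_diag (b₁ : Basis ι H₁) (b₂ : Basis ι H₂) :
    lieSpan K (diag b₁ b₂) (range (diagE b₁ b₂) ∪ range (diagF b₁ b₂)) = ⊤ := by
  have hr : range (diagE b₁ b₂) ∪ range (diagF b₁ b₂) = Subtype.val ⁻¹'
      (range (fun i ↦ (b₁.e i, b₂.e i)) ∪ range (fun i ↦ (b₁.f i, b₂.f i))) := by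
    ext; simp [Subtype.ext_iff]
  rw [hr]
  exact lieSpan_lieSpan_coe_preimage

/-- The diagonal generators form a basis when the Cartan matrices agree. -/
def diagBasis (b₁ : Basis ι H₁) (b₂ : Basis ι H₂) (hA : b₁.A = b₂.A) :
    Basis ι (lieSpan K (diag b₁ b₂) (range (diagH b₁ b₂))) where
  A := b₁.A
  h := diagH b₁ b₂
  e := diagE b₁ b₂
  f := diagF b₁ b₂
  cartan_eq_lieSpan := rfl
  span_ef := lieSpan_diag b₁ b₂
  linInd := .of_comp (diag b₁ b₂).subtype (.of_comp (LinearMap.fst K L₁ L₂) b₁.linInd)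
  nondegen := b₁.nondegen
  sl2 i :=
    { h_ne_zero := by simp [Subtype.ext_iff, (b₁.sl2 i).h_ne_zero]
      lie_e_f := by simp [Subtype.ext_iff, (b₁.sl2 i).lie_e_f, (b₂.sl2 i).lie_e_f]
      lie_h_e_nsmul := by
        simp [Subtype.ext_iff, (b₁.sl2 i).lie_h_e_nsmul, (b₂.sl2 i).lie_h_e_nsmul]
      lie_h_f_nsmul := by
        simp [Subtype.ext_iff, (b₁.sl2 i).lie_h_f_nsmul, (b₂.sl2 i).lie_h_f_nsmul] }
  lie_h_h i j := by simp [Subtype.ext_iff, b₁.lie_h_h, b₂.lie_h_h]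
  lie_h_e i j := by simp [Subtype.ext_iff, b₁.lie_h_e, b₂.lie_h_e, ← hA]
  lie_h_f i j := by simp [Subtype.ext_iff, b₁.lie_h_f, b₂.lie_h_f, ← hA]
  lie_e_f_ne i j hij := by
    simp [Subtype.ext_iff, b₁.lie_e_f_ne i j hij, b₂.lie_e_f_ne _ _ hij]

lemma surjective_of_map_generators {H' : LieSubalgebra K L} (b : Basis ι H') (b₁ : Basis ι H₁)
    (p : L →ₗ⁅K⁆ L₁) (he : ∀ i, p (b.e i) = b₁.e i) (hf : ∀ i, p (b.f i) = b₁.f i) :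
    Surjective p := by
  rw [← LieHom.range_eq_top, _root_.eq_top_iff, ← b₁.span_ef, LieSubalgebra.lieSpan_le]
  rintro _ (⟨i, rfl⟩ | ⟨i, rfl⟩)
  · exact ⟨b.e i, he i⟩
  · exact ⟨b.f i, hf i⟩

/-- Killing Lie algebras with bases having the same Cartan matrix are isomorphic. -/
theorem nonempty_equiv_of_A_eq [CharZero K] [FiniteDimensional K L₁] [FiniteDimensional K L₂]
    [IsKilling K L₁] [IsKilling K L₂] [H₁.IsCartanSubalgebra]
    [H₂.IsCartanSubalgebra] [IsTriangularizable K H₁ L₁] [IsTriangularizable K H₂ L₂]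
    (b₁ : Basis ι H₁) (b₂ : Basis ι H₂) (hA : b₁.A = b₂.A) : Nonempty (L₁ ≃ₗ⁅K⁆ L₂) := by
  let p : diag b₁ b₂ →ₗ⁅K⁆ L₁ := (LieHom.fst K L₁ L₂).comp (diag b₁ b₂).incl
  let q : diag b₁ b₂ →ₗ⁅K⁆ L₂ := (LieHom.snd K L₁ L₂).comp (diag b₁ b₂).incl
  let b := diagBasis b₁ b₂ hA
  have hp : Surjective p := surjective_of_map_generators b b₁ p (fun _ ↦ rfl) (fun _ ↦ rfl)
  have hq : Surjective q := surjective_of_map_generators b b₂ q (fun _ ↦ rfl) (fun _ ↦ rfl)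
  have hpq (x) (h1 : p x = 0) (h2 : q x = 0) : x = 0 := by
    obtain ⟨⟨x, y⟩, hx⟩ := x
    simp only [Subtype.ext_iff]
    exact Prod.ext h1 h2
  have hp' : Injective p :=
    injective_of_disjoint_ker b b₁ b₂ p q hq (fun _ ↦ rfl) (fun _ ↦ rfl) hpq
  have hq' : Injective q :=
    injective_of_disjoint_ker b b₂ b₁ q p hp (fun _ ↦ rfl) (fun _ ↦ rfl) fun x h1 h2 ↦ hpq x h2 h1
  exact ⟨(LieEquiv.ofBijective p ⟨hp', hp⟩).symm.trans (LieEquiv.ofBijective q ⟨hq', hq⟩)⟩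

end

end LieAlgebra.Basis

namespace LieAlgebra.IsKilling

open LieModule Module

section

variable {K L : Type*} [Field K] [CharZero K] [LieRing L] [LieAlgebra K L]
  [FiniteDimensional K L] [IsKilling K L] {H : LieSubalgebra K L} [H.IsCartanSubalgebra]
  [IsTriangularizable K H L]

lemma exists_smul_eq_of_mem_rootSpace {α : Weight K H L} (hα : α.IsNonZero) {x y : L}
    (hx : x ∈ rootSpace H α) (hx₀ : x ≠ 0) (hy : y ∈ rootSpace H α) : ∃ c : K, c • x = y := by
  have := (finrank_eq_one_iff_of_nonzero' (⟨x, hx⟩ : rootSpace H α)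
    (by simpa [Subtype.ext_iff] using hx₀)).mp (finrank_rootSpace_eq_one α hα) ⟨y, hy⟩
  obtain ⟨c, hc⟩ := this
  exact ⟨c, by simpa [Subtype.ext_iff] using hc⟩

/-- In a split semisimple Lie algebra `[𝔤_α, 𝔤_β]` does not vanish when `α`, `β` and `α + β` are
roots. -/
lemma lie_ne_zero_of_mem_rootSpace {α β γ : Weight K H L} (hα : α.IsNonZero) (hβ : β.IsNonZero)
    (hγ : (γ : H → K) = α + β) {x y : L} (hx : x ∈ rootSpace H α) (hx₀ : x ≠ 0)
    (hy : y ∈ rootSpace H β) (hy₀ : y ≠ 0) : ⁅x, y⁆ ≠ 0 := by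
  obtain ⟨h, e, f, t, he, hf⟩ := exists_isSl2Triple_of_weight_isNonZero hα
  obtain ⟨r, rfl⟩ := exists_smul_eq_of_mem_rootSpace hα hx hx₀ he
  have hr : r ≠ 0 := by
    rintro rfl
    exact t.e_ne_zero (by simp)
  intro hxy
  set e := r • x with he_def
  have hey : ⁅e, y⁆ = 0 := by simp [he_def, hxy]
  obtain rfl := t.h_eq_coroot hα he hf
  have hh {χ : H → K} {v : L} (hv : v ∈ rootSpace H χ) :
      ⁅((coroot α : H) : L), v⁆ = χ (coroot α) • v := by
    rw [← lie_eq_smul_of_mem_rootSpace hv]; rfl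
  have Py : t.HasPrimitiveVectorWith y (β (coroot α)) := ⟨hy₀, hh hy, hey⟩
  obtain ⟨n, hn⟩ := Py.exists_nat
  obtain ⟨z, hz, hz₀⟩ := γ.exists_ne_zero
  have hnil : ∃ k, (toEnd K L L e ^ k) z = 0 := by
    obtain ⟨k, hk⟩ := isNilpotent_toEnd_of_mem_rootSpace L H hα he
    exact ⟨k, by simp [hk]⟩
  obtain ⟨k, hk, hk'⟩ := Nat.exists_not_and_succ_of_not_zero_of_exists
    (p := fun k ↦ (toEnd K L L e ^ k) z = 0) (by simpa using hz₀) hnil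
  set w := (toEnd K L L e ^ k) z with hw_def
  have hw : w ∈ rootSpace H (k • (α : H → K) + γ) := toEnd_pow_apply_mem he hz k
  have hew : ⁅e, w⁆ = 0 := by
    rw [pow_succ', Module.End.mul_apply] at hk'
    exact hk'
  have hcoef : (k • (α : H → K) + γ) (coroot α) = ((n + 2 * (k + 1) : ℕ) : K) := by
    simp [hγ, hn, root_apply_coroot hα]
    ring
  have Pw : t.HasPrimitiveVectorWith w ((n + 2 * (k + 1) : ℕ) : K) :=
    ⟨hk, by rw [← hcoef]; exact hh hw, hew⟩
  set u := (toEnd K L L f ^ (k + 1)) w with hu_def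
  have hu : u ∈ rootSpace H β := by
    have := toEnd_pow_apply_mem hf hw (k + 1)
    convert this using 2
    rw [hγ, succ_nsmul, smul_neg]
    abel
  obtain ⟨c, hc⟩ := exists_smul_eq_of_mem_rootSpace hβ hy hy₀ hu
  have h1 : ⁅e, u⁆ = 0 := by rw [← hc, lie_smul, hey, smul_zero]
  rw [hu_def, Pw.lie_e_pow_succ_toEnd_f k, smul_eq_zero] at h1
  rcases h1 with h1 | h1
  · rw [mul_eq_zero] at h1
    rcases h1 with h1 | h1
    · exact Nat.cast_add_one_ne_zero k h1
    · rw [sub_eq_zero, Nat.cast_inj] at h1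
      omega
  · exact Pw.pow_toEnd_f_ne_zero_of_eq_nat rfl (by omega) h1

end

section

variable {K L : Type*} [Field K] [CharZero K] [LieRing L] [LieAlgebra K L]
  [FiniteDimensional K L] [IsKilling K L] {H : LieSubalgebra K L} [H.IsCartanSubalgebra]
  [IsTriangularizable K H L]

lemma exists_rootTriple (α : H.root) : ∃ e f : L,
    IsSl2Triple ((coroot (α : Weight K H L) : H) : L) e f ∧
      e ∈ rootSpace H (α : Weight K H L) ∧ f ∈ rootSpace H (-(α : Weight K H L)) := by
  obtain ⟨h, e, f, t, he, hf⟩ := exists_isSl2Triple_of_weight_isNonZero (H.isNonZero_coe_root α)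
  obtain rfl := t.h_eq_coroot (H.isNonZero_coe_root α) he hf
  exact ⟨e, f, t, he, hf⟩

/-- A root vector. -/
def rootE (α : H.root) : L := (exists_rootTriple α).choose

/-- A root vector for the opposite root, normalised with `rootE` to an `sl₂`-triple. -/
def rootF (α : H.root) : L := (exists_rootTriple α).choose_spec.choose

lemma isSl2Triple_root (α : H.root) :
    IsSl2Triple ((coroot (α : Weight K H L) : H) : L) (rootE α) (rootF α) :=
  (exists_rootTriple α).choose_spec.choose_spec.1

lemma rootE_mem (α : H.root) : rootE α ∈ rootSpace H (α : Weight K H L) :=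
  (exists_rootTriple α).choose_spec.choose_spec.2.1

lemma rootF_mem (α : H.root) : rootF α ∈ rootSpace H (-(α : Weight K H L)) :=
  (exists_rootTriple α).choose_spec.choose_spec.2.2

lemma exists_smul_rootE {α : H.root} {x : L} (hx : x ∈ rootSpace H (α : Weight K H L)) :
    ∃ c : K, c • rootE α = x :=
  exists_smul_eq_of_mem_rootSpace (H.isNonZero_coe_root α) (rootE_mem α)
    (isSl2Triple_root α).e_ne_zero hx

lemma exists_smul_rootF {α : H.root} {x : L} (hx : x ∈ rootSpace H (-(α : Weight K H L))) :
    ∃ c : K, c • rootF α = x :=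
  exists_smul_eq_of_mem_rootSpace (H.isNonZero_coe_root α).neg (rootF_mem α)
    (isSl2Triple_root α).f_ne_zero hx

lemma coe_eq_add_of_root_eq_add {α β γ : H.root}
    (h : (rootSystem H).root γ = (rootSystem H).root α + (rootSystem H).root β) :
    ((γ : Weight K H L) : H → K) = (α : Weight K H L) + (β : Weight K H L) := by
  ext x
  simpa using congr($h x)

lemma exists_smul_lie_rootE {α β γ : H.root}
    (h : (rootSystem H).root γ = (rootSystem H).root α + (rootSystem H).root β) {x : L}
    (hx : x ∈ rootSpace H (γ : Weight K H L)) : ∃ c : K, c • ⁅rootE α, rootE β⁆ = x := by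
  have h' := coe_eq_add_of_root_eq_add h
  refine exists_smul_eq_of_mem_rootSpace (H.isNonZero_coe_root γ) ?_
    (lie_ne_zero_of_mem_rootSpace (H.isNonZero_coe_root α) (H.isNonZero_coe_root β) h'
      (rootE_mem α) (isSl2Triple_root α).e_ne_zero (rootE_mem β)
      (isSl2Triple_root β).e_ne_zero) hx
  rw [h']
  exact lie_mem_genWeightSpace_of_mem_genWeightSpace (rootE_mem α) (rootE_mem β)

lemma exists_smul_lie_rootF {α β γ : H.root}
    (h : (rootSystem H).root γ = (rootSystem H).root α + (rootSystem H).root β) {x : L}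
    (hx : x ∈ rootSpace H (-(γ : Weight K H L))) : ∃ c : K, c • ⁅rootF α, rootF β⁆ = x := by
  have h' : ((-(γ : Weight K H L) : Weight K H L) : H → K) =
      (-(α : Weight K H L) : Weight K H L) + (-(β : Weight K H L) : Weight K H L) := by
    simp only [Weight.coe_neg, coe_eq_add_of_root_eq_add h, neg_add]
  refine exists_smul_eq_of_mem_rootSpace (α := -(γ : Weight K H L)) (H.isNonZero_coe_root γ).neg ?_
    (lie_ne_zero_of_mem_rootSpace (H.isNonZero_coe_root α).neg (H.isNonZero_coe_root β).neg h'
      (rootF_mem α) (isSl2Triple_root α).f_ne_zero (rootF_mem β)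
      (isSl2Triple_root β).f_ne_zero) hx
  rw [h']
  exact lie_mem_genWeightSpace_of_mem_genWeightSpace (rootF_mem α) (rootF_mem β)

lemma lie_coe_of_mem_rootSpace {χ : H → K} {x : L} (hx : x ∈ rootSpace H χ) (h : H) :
    ⁅(h : L), x⁆ = χ h • x := by
  rw [← lie_eq_smul_of_mem_rootSpace hx]
  rfl

variable (b : (rootSystem H).Base)

lemma isPos_decompose {α : H.root} (hα : b.IsPos α) :
    α ∈ b.support ∨ ∃ β γ, b.IsPos β ∧ γ ∈ b.support ∧
      (rootSystem H).root α = (rootSystem H).root β + (rootSystem H).root γ := by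
  have : b.IsPos α ∧ (α ∈ b.support ∨ ∃ β γ, b.IsPos β ∧ γ ∈ b.support ∧
      (rootSystem H).root α = (rootSystem H).root β + (rootSystem H).root γ) := by
    refine hα.induction_on_add (p := fun α ↦ b.IsPos α ∧ (α ∈ b.support ∨ ∃ β γ, b.IsPos β ∧
      γ ∈ b.support ∧ (rootSystem H).root α = (rootSystem H).root β + (rootSystem H).root γ))
      (fun i hi ↦ ⟨b.isPos_of_mem_support hi, .inl hi⟩) ?_
    intro i j k hk hi hj
    exact ⟨hi.1.add (b.isPos_of_mem_support hj) hk, .inr ⟨i, j, hi.1, hj, hk⟩⟩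
  exact this.2

lemma rootSpace_le_lieSpan (S : LieSubalgebra K L)
    (he : ∀ i ∈ b.support, rootE i ∈ S) (hf : ∀ i ∈ b.support, rootF i ∈ S) (α : H.root) :
    (rootSpace H (α : Weight K H L)).toSubmodule ≤ S.toSubmodule := by
  have key {β : H.root} (hβ : b.IsPos β) : rootE β ∈ S ∧ rootF β ∈ S := by
    refine hβ.induction_on_add (p := fun β ↦ rootE β ∈ S ∧ rootF β ∈ S) (fun i hi ↦ ⟨he i hi, hf i hi⟩) ?_
    rintro i j k hk ⟨h1, h2⟩ hj
    obtain ⟨c, hc⟩ := exists_smul_lie_rootE hk (rootE_mem k)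
    obtain ⟨d, hd⟩ := exists_smul_lie_rootF hk (rootF_mem k)
    exact ⟨hc ▸ S.smul_mem _ (S.lie_mem h1 (he j hj)), hd ▸ S.smul_mem _ (S.lie_mem h2 (hf j hj))⟩
  intro x hx
  let := (rootSystem H).indexNeg
  rcases RootPairing.Base.IsPos.or_neg b α with hα | hα
  · obtain ⟨c, rfl⟩ := exists_smul_rootE (x := x) hx
    exact S.smul_mem _ (key hα).1
  · have h1 : (((-α : H.root) : Weight K H L) : H → K) = -((α : Weight K H L) : H → K) := by
      have h2 : (rootSystem H).root (-α) = -(rootSystem H).root α := by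
        rw [RootPairing.indexNeg_neg, RootPairing.root_reflectionPerm,
          RootPairing.reflection_apply_self]
      ext y
      exact congr($h2 y)
    obtain ⟨c, rfl⟩ := exists_smul_rootF (α := -α) (x := x) (by rw [h1, neg_neg]; exact hx)
    exact S.smul_mem _ (key hα).2

lemma span_coroot_base :
    H.toSubmodule = Submodule.span K
      (Set.range fun i : b.support ↦ ((coroot (i : Weight K H L) : H) : L)) := by
  have h1 := b.span_coroot_support
  have h2 : Submodule.map H.toSubmodule.subtype (Submodule.span K
      ((rootSystem H).coroot '' b.support)) = H.toSubmodule := by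
    rw [h1, RootPairing.corootSpan, RootPairing.IsRootSystem.span_coroot_eq_top]
    simp
  rw [← h2, Submodule.map_span]
  congr 1
  ext x
  simp

lemma lieSpan_eq_top : LieSubalgebra.lieSpan K L
    (Set.range (fun i : b.support ↦ rootE (i : H.root)) ∪
      Set.range (fun i : b.support ↦ rootF (i : H.root))) = ⊤ := by
  set S := LieSubalgebra.lieSpan K L (Set.range (fun i : b.support ↦ rootE (i : H.root)) ∪
      Set.range (fun i : b.support ↦ rootF (i : H.root))) with hS
  have he : ∀ i ∈ b.support, rootE i ∈ S := fun i hi ↦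
    LieSubalgebra.subset_lieSpan (.inl ⟨⟨i, hi⟩, rfl⟩)
  have hf : ∀ i ∈ b.support, rootF i ∈ S := fun i hi ↦
    LieSubalgebra.subset_lieSpan (.inr ⟨⟨i, hi⟩, rfl⟩)
  have hH : H.toSubmodule ≤ S.toSubmodule := by
    rw [span_coroot_base b, Submodule.span_le]
    rintro _ ⟨i, rfl⟩
    have := (isSl2Triple_root (i : H.root)).lie_e_f
    simp only [← this]
    exact S.lie_mem (he i i.2) (hf i i.2)
  rw [eq_top_iff]
  intro x _
  have hx : x ∈ ⨆ χ : Weight K H L, genWeightSpace L χ := by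
    rw [iSup_genWeightSpace_eq_top' K H L]
    trivial
  rw [← LieSubmodule.mem_toSubmodule, LieSubmodule.iSup_toSubmodule] at hx
  refine (iSup_le fun χ ↦ ?_ : _ ≤ S.toSubmodule) hx
  by_cases hχ : χ.IsZero
  · intro y hy
    have hy' : y ∈ rootSpace H (0 : H → K) := by
      rw [← hχ.eq]
      exact hy
    rw [rootSpace_zero_eq] at hy'
    exact hH hy'
  · exact rootSpace_le_lieSpan b S he hf ⟨χ, by simpa using hχ⟩

lemma sub_ne_weight {i j : H.root} (hi : i ∈ b.support) (hj : j ∈ b.support) (hij : i ≠ j) :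
    rootSpace H ((i : Weight K H L) - (j : Weight K H L) : H → K) = ⊥ := by
  by_contra h
  let w : Weight K H L := ⟨_, h⟩
  have hw : w.IsNonZero := by
    intro h0
    apply hij
    have h0 : (w : H → K) = 0 := h0
    have : ((i : Weight K H L) : H → K) = (j : Weight K H L) := sub_eq_zero.mp h0
    exact Subtype.ext (DFunLike.coe_injective this)
  refine b.sub_notMem_range_root hi hj ⟨⟨w, by simpa using hw⟩, ?_⟩
  ext x
  simp [w]

lemma lie_rootE_rootF_of_ne {i j : H.root} (hi : i ∈ b.support) (hj : j ∈ b.support)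
    (hij : i ≠ j) : ⁅rootE i, rootF j⁆ = 0 := by
  have := lie_mem_genWeightSpace_of_mem_genWeightSpace (rootE_mem i) (rootF_mem j)
  rw [← sub_eq_add_neg] at this
  simpa [sub_ne_weight b hi hj hij] using this

/-- The Chevalley basis data attached to a base of the root system. -/
def chevalleyBasis : LieAlgebra.Basis b.support H where
  A := b.cartanMatrix
  h i := ((coroot (i : Weight K H L) : H) : L)
  e i := rootE (i : H.root)
  f i := rootF (i : H.root)
  cartan_eq_lieSpan := by
    rw [← LieSubalgebra.toSubmodule_inj, span_coroot_base b]
    symm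
    apply LieSubalgebra.coe_lieSpan_eq_span_of_forall_lie_eq_zero
    rintro _ ⟨i, rfl⟩ _ ⟨j, rfl⟩
    rw [← LieSubalgebra.coe_bracket, trivial_lie_zero, ZeroMemClass.coe_zero]
  span_ef := lieSpan_eq_top b
  linInd := by
    have := b.linearIndepOn_coroot
    exact LinearIndependent.map' this H.toSubmodule.subtype (Submodule.ker_subtype _)
  nondegen := b.cartanMatrix_nondegenerate
  sl2 i := isSl2Triple_root (i : H.root)
  lie_h_h i j := by rw [← LieSubalgebra.coe_bracket, trivial_lie_zero, ZeroMemClass.coe_zero]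
  lie_h_e i j := by
    rw [lie_coe_of_mem_rootSpace (rootE_mem (i : H.root)), ← Int.cast_smul_eq_zsmul K]
    congr 1
    have := b.algebraMap_cartanMatrixIn_apply ℤ i j
    simp only [rootSystem_pairing_apply] at this
    exact this.symm
  lie_h_f i j := by
    rw [lie_coe_of_mem_rootSpace (rootF_mem (i : H.root)), ← Int.cast_smul_eq_zsmul K]
    congr 1
    have := b.algebraMap_cartanMatrixIn_apply ℤ i j
    simp only [rootSystem_pairing_apply] at this
    rw [Pi.neg_apply, ← this]
    simp
  lie_e_f_ne i j hij := lie_rootE_rootF_of_ne b i.2 j.2 (fun h ↦ hij (Subtype.ext h))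

lemma exists_nat_ad_rootE_pow_eq_zero_iff {i j : b.support} (hij : i ≠ j) :
    ∃ N : ℕ, b.cartanMatrix j i = -N ∧
      ∀ m : ℕ, (LieAlgebra.ad K L (rootE (i : H.root)) ^ m) (rootE (j : H.root)) = 0 ↔ N < m := by
  have t := (isSl2Triple_root (i : H.root)).symm
  have hA := b.algebraMap_cartanMatrixIn_apply ℤ j i
  simp only [rootSystem_pairing_apply] at hA
  have P : t.HasPrimitiveVectorWith (rootE (j : H.root)) (-(b.cartanMatrix j i : K)) := by
    refine ⟨(isSl2Triple_root (j : H.root)).e_ne_zero, ?_, ?_⟩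
    · rw [neg_lie, lie_coe_of_mem_rootSpace (rootE_mem (j : H.root)), ← hA, neg_smul]
      rfl
    · rw [← lie_skew, lie_rootE_rootF_of_ne b j.2 i.2
        (fun h ↦ hij (Subtype.ext h).symm), neg_zero]
  obtain ⟨N, hN⟩ := P.exists_nat
  refine ⟨N, ?_, fun m ↦ ⟨fun h ↦ ?_, fun h ↦ ?_⟩⟩
  · rw [neg_eq_iff_eq_neg] at hN
    exact_mod_cast hN
  · by_contra! hm
    exact P.pow_toEnd_f_ne_zero_of_eq_nat hN hm h
  · exact Module.End.pow_map_zero_of_le (Nat.succ_le_of_lt h) (P.pow_toEnd_f_eq_zero_of_eq_nat hN)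

end

end LieAlgebra.IsKilling

/-- Reindex a basis of a Lie algebra along an equivalence. -/
def LieAlgebra.Basis.reindex {ι ι' K L : Type*} [Finite ι] [Finite ι'] [Field K] [LieRing L]
    [LieAlgebra K L] {H : LieSubalgebra K L} (b : LieAlgebra.Basis ι H) (σ : ι' ≃ ι) :
    LieAlgebra.Basis ι' H where
  A := b.A.submatrix σ σ
  h := b.h ∘ σ
  e := b.e ∘ σ
  f := b.f ∘ σ
  cartan_eq_lieSpan := by rw [σ.surjective.range_comp, ← b.cartan_eq_lieSpan]
  span_ef := by rw [σ.surjective.range_comp, σ.surjective.range_comp, b.span_ef]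
  linInd := b.linInd.comp σ σ.injective
  nondegen := by
    classical
    cases nonempty_fintype ι
    cases nonempty_fintype ι'
    rw [Matrix.nondegenerate_iff_det_ne_zero, Matrix.det_submatrix_equiv_self,
      ← Matrix.nondegenerate_iff_det_ne_zero]
    exact b.nondegen
  sl2 i := b.sl2 (σ i)
  lie_h_h i j := b.lie_h_h (σ i) (σ j)
  lie_h_e i j := b.lie_h_e (σ i) (σ j)
  lie_h_f i j := b.lie_h_f (σ i) (σ j)
  lie_e_f_ne i j hij := b.lie_e_f_ne (σ i) (σ j) (σ.injective.ne hij)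

namespace LieAlgebra.IsKilling

open LieModule Module

lemma coe_root_injective {L : Type*} [LieRing L] [LieAlgebra ℝ L] [FiniteDimensional ℝ L]
    {H : LieSubalgebra ℝ L} [H.IsCartanSubalgebra] {α β : H.root}
    (h : ((α : Weight ℝ H L) : H → ℝ) = (β : Weight ℝ H L)) : α = β :=
  Subtype.ext (DFunLike.coe_injective h)

lemma coe_ad_pow_apply {L : Type*} [LieRing L] [LieAlgebra ℝ L] {n : LieSubalgebra ℝ L}
    (x y : n) (m : ℕ) :
    (((LieAlgebra.ad ℝ n x) ^ m) y : L) = ((LieAlgebra.ad ℝ L (x : L)) ^ m) (y : L) := by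
  induction m with
  | zero => simp
  | succ m ih => simp [pow_succ', ih]

section

variable {L : Type*} [LieRing L] [LieAlgebra ℝ L] [FiniteDimensional ℝ L] [IsKilling ℝ L]
  {H : LieSubalgebra ℝ L} [H.IsCartanSubalgebra] [IsTriangularizable ℝ H L]
  (b : (rootSystem H).Base)

/-- The sum of the positive root spaces. -/
def posPart : Submodule ℝ L :=
  ⨆ α : {α : H.root // b.IsPos α}, (rootSpace H (α.1 : Weight ℝ H L)).toSubmodule

variable {b} {n : LieSubalgebra ℝ L}

lemma rootSpace_le_of_isPos (hn : n.toSubmodule = posPart b) {α : H.root} (hα : b.IsPos α) {x : L}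
    (hx : x ∈ rootSpace H (α : Weight ℝ H L)) : x ∈ n := by
  rw [← LieSubalgebra.mem_toSubmodule, hn]
  exact Submodule.mem_iSup_of_mem (⟨α, hα⟩ : {α : H.root // b.IsPos α}) hx

lemma posPart_induction (hn : n.toSubmodule = posPart b) {p : n → Prop}
    (mem : ∀ α : H.root, b.IsPos α → ∀ x : n, (x : L) ∈ rootSpace H (α : Weight ℝ H L) → p x)
    (zero : p 0) (add : ∀ x y, p x → p y → p (x + y)) (x : n) : p x := by
  have key : ∀ y : L, y ∈ posPart b → ∃ h : y ∈ n, p ⟨y, h⟩ := by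
    intro y hy
    refine Submodule.iSup_induction _ (motive := fun y ↦ ∃ h : y ∈ n, p ⟨y, h⟩) hy ?_ ?_ ?_
    · intro α y hy
      exact ⟨rootSpace_le_of_isPos hn α.2 hy, mem α.1 α.2 _ hy⟩
    · exact ⟨n.zero_mem, zero⟩
    · rintro y z ⟨hy, hy'⟩ ⟨hz, hz'⟩
      exact ⟨n.add_mem hy hz, add _ _ hy' hz'⟩
  have hx : (x : L) ∈ posPart b := by
    rw [← hn]
    exact x.2
  exact (key x hx).2

lemma lie_mem_posPart (hn : n.toSubmodule = posPart b) (h : H) (x : n) : ⁅(h : L), (x : L)⁆ ∈ n := by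
  refine posPart_induction hn (p := fun x ↦ ⁅(h : L), (x : L)⁆ ∈ n) ?_ (by simp) ?_ x
  · intro α hα x hx
    rw [lie_coe_of_mem_rootSpace hx]
    exact n.smul_mem _ x.2
  · intro x y hx hy
    simpa using n.add_mem hx hy

/-- The derivation of the sum of the positive root spaces defined by an element of the Cartan
subalgebra. -/
def cartanDerivation (hn : n.toSubmodule = posPart b) (h : H) : LieDerivation ℝ n n where
  toFun x := ⟨⁅(h : L), (x : L)⁆, lie_mem_posPart hn h x⟩
  map_add' x y := by ext; simp
  map_smul' c x := by ext; simp
  leibniz' x y := by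
    ext
    simp only [LinearMap.coe_mk, AddHom.coe_mk, LieSubalgebra.coe_bracket,
      AddSubgroupClass.coe_sub]
    rw [leibniz_lie, ← lie_skew (y : L) ⁅(h : L), (x : L)⁆]
    abel

lemma cartanDerivation_apply (hn : n.toSubmodule = posPart b) (h : H) (α : H.root) (x : n)
    (hx : (x : L) ∈ rootSpace H (α : Weight ℝ H L)) :
    cartanDerivation hn h x = (α : Weight ℝ H L) h • x := by
  ext
  exact lie_coe_of_mem_rootSpace hx h

lemma iSup_eigenspace_cartanDerivation (hn : n.toSubmodule = posPart b) (h : H) {ν : ℕ → ℝ}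
    (hh : ∀ α : H.root, b.IsPos α → ∃ m : ℕ, (α : Weight ℝ H L) h = ν m) :
    ⨆ m : ℕ, Module.End.eigenspace (cartanDerivation hn h).toLinearMap (ν m) = ⊤ := by
  rw [eq_top_iff]
  rintro x -
  refine posPart_induction hn (p := fun x ↦ x ∈ ⨆ m : ℕ, Module.End.eigenspace
    (cartanDerivation hn h).toLinearMap (ν m)) ?_ (Submodule.zero_mem _)
    (fun x y ↦ Submodule.add_mem _) x
  intro α hα x hx
  obtain ⟨m, hm⟩ := hh α hα
  refine Submodule.mem_iSup_of_mem m ?_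
  rw [Module.End.mem_eigenspace_iff, ← hm]
  exact cartanDerivation_apply hn h α x hx

variable (b) in
/-- The basis of the Cartan subalgebra dual to the simple roots. -/
def coweight (i : b.support) : H :=
  (Module.evalEquiv ℝ H).symm (b.toWeightBasis.coord i)

lemma apply_coweight [DecidableEq b.support] (i j : b.support) :
    ((j : H.root) : Weight ℝ H L) (coweight b i) = if i = j then 1 else 0 := by
  have h1 := Module.apply_evalEquiv_symm_apply (R := ℝ) (M := H) (b.toWeightBasis j)
    (b.toWeightBasis.coord i)
  rw [Basis.coord_apply, Basis.repr_self, Finsupp.single_apply, b.toWeightBasis_apply] at h1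
  simp only [@eq_comm _ i j]
  exact h1

lemma apply_eq_add_of_root_eq_add {α β γ : H.root}
    (h : (rootSystem H).root γ = (rootSystem H).root α + (rootSystem H).root β) (x : H) :
    (γ : Weight ℝ H L) x = (α : Weight ℝ H L) x + (β : Weight ℝ H L) x :=
  congrFun (coe_eq_add_of_root_eq_add h) x

lemma exists_nat_apply_coweight {α : H.root} (hα : b.IsPos α) (i : b.support) :
    ∃ m : ℕ, (α : Weight ℝ H L) (coweight b i) = m := by
  classical
  refine hα.induction_on_add (p := fun α ↦ ∃ m : ℕ, (α : Weight ℝ H L) (coweight b i) = m) ?_ ?_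
  · intro j hj
    rw [apply_coweight i ⟨j, hj⟩]
    split_ifs
    exacts [⟨1, by simp⟩, ⟨0, by simp⟩]
  · rintro α j γ h ⟨m, hm⟩ hj
    rw [apply_eq_add_of_root_eq_add h, hm, apply_coweight i ⟨j, hj⟩]
    split_ifs
    exacts [⟨m + 1, by simp⟩, ⟨m, by simp⟩]

lemma apply_sum_coweight (j : b.support) :
    ((j : H.root) : Weight ℝ H L) (∑ i, coweight b i) = 1 := by
  classical
  have : ((j : H.root) : Weight ℝ H L) (∑ i, coweight b i) =
      ∑ i, ((j : H.root) : Weight ℝ H L) (coweight b i) :=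
    map_sum (((j : H.root) : Weight ℝ H L).toLinear) _ _
  rw [this]
  simp [apply_coweight]

lemma exists_nat_apply_sum_coweight {α : H.root} (hα : b.IsPos α) :
    ∃ m : ℕ, (α : Weight ℝ H L) (∑ i, coweight b i) = m + 1 := by
  refine hα.induction_on_add (p := fun α ↦ ∃ m : ℕ, (α : Weight ℝ H L) (∑ i, coweight b i) = m + 1)
    ?_ ?_
  · intro j hj
    rw [apply_sum_coweight ⟨j, hj⟩]
    exact ⟨0, by simp⟩
  · rintro α j γ h ⟨m, hm⟩ hj
    rw [apply_eq_add_of_root_eq_add h, hm, apply_sum_coweight ⟨j, hj⟩]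
    exact ⟨m + 1, by simp⟩

variable (b n) in
/-- The coordinate of a simple root vector. -/
def simpleCoord (i : b.support) : Module.Dual ℝ n :=
  (killingForm ℝ L (rootE (i : H.root)) (rootF (i : H.root)))⁻¹ •
    (killingForm ℝ L (rootF (i : H.root))) ∘ₗ n.toSubmodule.subtype

lemma simpleCoord_apply (i : b.support) (x : n) :
    simpleCoord b n i x = (killingForm ℝ L (rootE (i : H.root)) (rootF (i : H.root)))⁻¹ *
      killingForm ℝ L (rootF (i : H.root)) (x : L) :=
  rfl

lemma killingForm_rootE_rootF_ne_zero (α : H.root) :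
    killingForm ℝ L (rootE α) (rootF α) ≠ 0 := by
  intro h
  have := lie_eq_killingForm_smul_of_mem_rootSpace_of_mem_rootSpace_neg (rootE_mem α) (rootF_mem α)
  rw [h, (isSl2Triple_root α).lie_e_f, zero_smul] at this
  exact (isSl2Triple_root α).h_ne_zero this

lemma simpleCoord_eq_zero (i : b.support) {χ : H → ℝ}
    (hχ : χ ≠ ((i : H.root) : Weight ℝ H L)) {x : n} (hx : (x : L) ∈ rootSpace H χ) :
    simpleCoord b n i x = 0 := by
  have : killingForm ℝ L (rootF (i : H.root)) (x : L) = 0 :=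
    killingForm_apply_eq_zero_of_mem_rootSpace_of_add_ne_zero ℝ L H (rootF_mem (i : H.root)) hx
      (fun h ↦ hχ (neg_add_eq_zero.mp h).symm)
  rw [simpleCoord_apply, this, mul_zero]

lemma simpleCoord_rootE (i : b.support) {x : n} (hx : (x : L) = rootE (i : H.root)) :
    simpleCoord b n i x = 1 := by
  have h := killingForm_rootE_rootF_ne_zero (i : H.root)
  have : killingForm ℝ L (rootF (i : H.root)) (rootE (i : H.root)) =
    killingForm ℝ L (rootE (i : H.root)) (rootF (i : H.root)) := traceForm_comm ℝ L L _ _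
  rw [simpleCoord_apply, hx, this, inv_mul_cancel₀ h]

lemma simpleCoord_lie (hn : n.toSubmodule = posPart b) (i : b.support) (x y : n) :
    simpleCoord b n i ⁅x, y⁆ = 0 := by
  refine posPart_induction hn (p := fun x ↦ simpleCoord b n i ⁅x, y⁆ = 0) ?_ (by simp) ?_ x
  · intro α hα x hx
    refine posPart_induction hn (p := fun y ↦ simpleCoord b n i ⁅x, y⁆ = 0) ?_ (by simp) ?_ y
    · intro β hβ y hy
      refine simpleCoord_eq_zero i ?_ (lie_mem_genWeightSpace_of_mem_genWeightSpace hx hy)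
      intro h
      obtain ⟨k, hk⟩ := exists_nat_apply_sum_coweight hα
      obtain ⟨l, hl⟩ := exists_nat_apply_sum_coweight hβ
      have := congrFun h (∑ i, coweight b i)
      rw [Pi.add_apply, hk, hl, apply_sum_coweight] at this
      norm_cast at this
      omega
    · intro y z hy hz
      simp [hy, hz]
  · intro x z hx hz
    simp [hx, hz]

lemma mem_span_lie_of_simpleCoord_eq_zero (hn : n.toSubmodule = posPart b) (x : n)
    (hx : ∀ i, simpleCoord b n i x = 0) :
    x ∈ Submodule.span ℝ {z | ∃ x y : n, ⁅x, y⁆ = z} := by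
  classical
  set e : b.support → n := fun i ↦ ⟨rootE (i : H.root),
    rootSpace_le_of_isPos hn (b.isPos_of_mem_support i.2) (rootE_mem (i : H.root))⟩ with he
  suffices x - ∑ i, simpleCoord b n i x • e i ∈ Submodule.span ℝ {z | ∃ x y : n, ⁅x, y⁆ = z} by
    simpa [hx] using this
  clear hx
  refine posPart_induction hn (p := fun x ↦ x - ∑ i, simpleCoord b n i x • e i ∈
    Submodule.span ℝ {z | ∃ x y : n, ⁅x, y⁆ = z}) ?_ (by simp) ?_ x
  · intro α hα x hx
    rcases isPos_decompose b hα with hα' | ⟨β, γ, hβ, hγ, h⟩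
    · obtain ⟨c, hc⟩ := exists_smul_rootE hx
      have hxc : x = c • e ⟨α, hα'⟩ := Subtype.ext hc.symm
      have : ∑ i, simpleCoord b n i x • e i = x := by
        rw [Finset.sum_eq_single ⟨α, hα'⟩]
        · rw [hxc, map_smul, simpleCoord_rootE ⟨α, hα'⟩ rfl, smul_eq_mul, mul_one]
        · intro i _ hi
          rw [simpleCoord_eq_zero i (fun h ↦ hi (Subtype.ext (coe_root_injective h).symm)) hx,
            zero_smul]
        · simp
      rw [this, sub_self]
      exact Submodule.zero_mem _
    · have : ∑ i, simpleCoord b n i x • e i = 0 := by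
        refine Finset.sum_eq_zero fun i _ ↦ ?_
        rw [simpleCoord_eq_zero i _ hx, zero_smul]
        intro h'
        obtain ⟨k, hk⟩ := exists_nat_apply_sum_coweight hβ
        have := congrFun h' (∑ i, coweight b i)
        rw [apply_sum_coweight, apply_eq_add_of_root_eq_add h, hk,
          apply_sum_coweight ⟨γ, hγ⟩] at this
        norm_cast at this
        omega
      rw [this, sub_zero]
      obtain ⟨c, hc⟩ := exists_smul_lie_rootE h hx
      have hx' : x = c • ⁅(⟨rootE β, rootSpace_le_of_isPos hn hβ (rootE_mem β)⟩ : n),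
          (⟨rootE γ, rootSpace_le_of_isPos hn (b.isPos_of_mem_support hγ) (rootE_mem γ)⟩ : n)⁆ :=
        Subtype.ext hc.symm
      rw [hx']
      exact Submodule.smul_mem _ _ (Submodule.subset_span ⟨_, _, rfl⟩)
  · intro x y hx hy
    have := Submodule.add_mem _ hx hy
    convert this using 1
    simp only [map_add, add_smul, Finset.sum_add_distrib]
    abel

/-- The frame of the sum of the positive root spaces defined by simple root vectors. -/
def posFrame (hn : n.toSubmodule = posPart b) [DecidableEq b.support] :
    NilpotentFrame n b.support where
  e i := ⟨rootE (i : H.root),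
    rootSpace_le_of_isPos hn (b.isPos_of_mem_support i.2) (rootE_mem (i : H.root))⟩
  c := simpleCoord b n
  deriv i := cartanDerivation hn (coweight b i)
  height := cartanDerivation hn (∑ i, coweight b i)
  c_e i j := by
    split_ifs with h
    · subst h
      exact simpleCoord_rootE i rfl
    · exact simpleCoord_eq_zero i (fun h' ↦ h (Subtype.ext (coe_root_injective h').symm))
        (rootE_mem (j : H.root))
  c_lie := simpleCoord_lie hn
  mem_span_lie := mem_span_lie_of_simpleCoord_eq_zero hn
  deriv_e i j := by
    rw [cartanDerivation_apply hn _ (j : H.root) _ (rootE_mem (j : H.root)), apply_coweight]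
    simp
  iSup_deriv i := iSup_eigenspace_cartanDerivation hn _
    fun α hα ↦ exists_nat_apply_coweight hα i
  height_e i := by
    rw [cartanDerivation_apply hn _ (i : H.root) _ (rootE_mem (i : H.root)), apply_sum_coweight,
      one_smul]
  iSup_height := iSup_eigenspace_cartanDerivation hn _
    fun α hα ↦ exists_nat_apply_sum_coweight hα

lemma exists_nat_ad_posFrame_e_pow_eq_zero_iff (hn : n.toSubmodule = posPart b)
    [DecidableEq b.support] {i j : b.support} (hij : i ≠ j) :
    ∃ N : ℕ, b.cartanMatrix j i = -N ∧ ∀ m : ℕ,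
      (LieAlgebra.ad ℝ n ((posFrame hn).e i) ^ m) ((posFrame hn).e j) = 0 ↔ N < m := by
  obtain ⟨N, h1, h2⟩ := exists_nat_ad_rootE_pow_eq_zero_iff b hij
  refine ⟨N, h1, fun m ↦ ?_⟩
  rw [← h2, ← ZeroMemClass.coe_eq_zero, coe_ad_pow_apply]
  rfl

end

/-- Split real semisimple Lie algebras with isomorphic sums of positive root spaces are
isomorphic. -/
theorem nonempty_equiv_of_posPart {L₁ L₂ : Type*} [LieRing L₁] [LieAlgebra ℝ L₁]
    [FiniteDimensional ℝ L₁] [IsKilling ℝ L₁] [LieRing L₂] [LieAlgebra ℝ L₂]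
    [FiniteDimensional ℝ L₂] [IsKilling ℝ L₂]
    {H₁ : LieSubalgebra ℝ L₁} [H₁.IsCartanSubalgebra] [IsTriangularizable ℝ H₁ L₁]
    {H₂ : LieSubalgebra ℝ L₂} [H₂.IsCartanSubalgebra] [IsTriangularizable ℝ H₂ L₂]
    {b₁ : (rootSystem H₁).Base} {b₂ : (rootSystem H₂).Base}
    {n₁ : LieSubalgebra ℝ L₁} {n₂ : LieSubalgebra ℝ L₂}
    (hn₁ : n₁.toSubmodule = posPart b₁) (hn₂ : n₂.toSubmodule = posPart b₂)
    (φ : n₁ ≃ₗ⁅ℝ⁆ n₂) : Nonempty (L₁ ≃ₗ⁅ℝ⁆ L₂) := by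
  classical
  obtain ⟨σ, hσ⟩ := (posFrame hn₁).exists_equiv_ad_pow_iff (posFrame hn₂) φ
  have hA (i j : b₁.support) : b₁.cartanMatrix i j = b₂.cartanMatrix (σ i) (σ j) := by
    rcases eq_or_ne j i with rfl | hij
    · simp
    obtain ⟨N, hN, h⟩ := exists_nat_ad_posFrame_e_pow_eq_zero_iff hn₁ hij
    obtain ⟨N', hN', h'⟩ := exists_nat_ad_posFrame_e_pow_eq_zero_iff hn₂ (σ.injective.ne hij)
    have key (m : ℕ) : N < m ↔ N' < m := by rw [← h, ← h', hσ]
    have h1 := key (N + 1)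
    have h2 := key (N' + 1)
    rw [hN, hN']
    omega
  refine (chevalleyBasis b₁).nonempty_equiv_of_A_eq ((chevalleyBasis b₂).reindex σ) ?_
  ext i j
  exact hA i j

end LieAlgebra.IsKilling

lemma LinearMap.BilinForm.iSup_eigenspace_eq_top {V : Type*} [AddCommGroup V] [Module ℝ V]
    [FiniteDimensional ℝ V] (B : LinearMap.BilinForm ℝ V) (hB : ∀ x y, B x y = B y x)
    (hpos : ∀ x, x ≠ 0 → 0 < B x x) (T : Module.End ℝ V) (hT : ∀ x y, B (T x) y = B x (T y)) :
    ⨆ μ, Module.End.eigenspace T μ = ⊤ := by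
  let c : InnerProductSpace.Core ℝ V :=
    { inner := fun x y ↦ B x y
      conj_inner_symm := fun x y ↦ hB y x
      re_inner_nonneg := fun x ↦ by
        rcases eq_or_ne x 0 with rfl | hx
        · simp
        · exact (hpos x hx).le
      add_left := fun x y z ↦ by simp
      smul_left := fun x y r ↦ by simp
      definite := fun x hx ↦ by
        by_contra h
        exact (hpos x h).ne' hx }
  let : NormedAddCommGroup V := c.toNormedAddCommGroup
  let : InnerProductSpace ℝ V := InnerProductSpace.ofCore c.toCore
  have h : T.IsSymmetric := hT
  rw [← Submodule.orthogonal_eq_bot_iff]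
  exact h.orthogonalComplement_iSup_eigenspaces_eq_bot

namespace LieAlgebra.IsKilling

open LieModule Module

lemma exists_base_forall_isPos_iff {L : Type*} [LieRing L] [LieAlgebra ℝ L]
    [FiniteDimensional ℝ L] [IsKilling ℝ L] {H : LieSubalgebra ℝ L} [H.IsCartanSubalgebra]
    [IsTriangularizable ℝ H L] (h₀ : H) (h : ∀ α : H.root, (α : Weight ℝ H L) h₀ ≠ 0) :
    ∃ b : (rootSystem H).Base, ∀ α : H.root, b.IsPos α ↔ 0 < (α : Weight ℝ H L) h₀ := by
  let P := rootSystem H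
  let f : Dual ℝ (Dual ℝ H) := Dual.eval ℝ H h₀
  have hf (α : H.root) : f (P.root α) = (α : Weight ℝ H L) h₀ := rfl
  have hf' (α : H.root) : f (P.root α) ≠ 0 := h α
  let := P.indexNeg
  let b : P.Base := RootPairing.Base.mk' P
    (IsAddIndecomposable.baseOf P.root (f : Dual ℝ H →+ ℝ)) (P.linearIndepOn_root_baseOf' f hf')
    fun i ↦ IsAddIndecomposable.mem_or_neg_mem_closure_baseOf P.root (f : Dual ℝ H →+ ℝ) i
      (hf' i) (by simp)
  have key (α : H.root) (hα : b.IsPos α) : 0 < f (P.root α) := by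
    have hs : ∀ i ∈ b.support, 0 < f (P.root i) :=
      fun i hi ↦ IsAddIndecomposable.baseOf_subset_pos P.root (f : Dual ℝ H →+ ℝ)
        ((Set.toFinite _).mem_toFinset.1 hi)
    refine hα.induction_on_add (p := fun i ↦ 0 < f (P.root i)) hs ?_
    intro i j k hk hi hj
    rw [hk, map_add]
    exact add_pos hi (hs j hj)
  refine ⟨b, fun α ↦ ⟨key α, fun hα ↦ ?_⟩⟩
  rcases RootPairing.Base.IsPos.or_neg b α with h' | h'
  · exact h'
  · have := key _ h'
    rw [RootPairing.indexNeg_neg, RootPairing.root_reflectionPerm,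
      RootPairing.reflection_apply_self, map_neg, hf] at this
    linarith

end LieAlgebra.IsKilling

section

open LieModule LieAlgebra.IsKilling

variable {L : Type*} [LieRing L] [LieAlgebra ℝ L] {θ : L ≃ₗ⁅ℝ⁆ L} {a : Submodule ℝ L}

/-- The bilinear form `-κ(x, θ y)` attached to an automorphism `θ`. -/
def cartanForm (θ : L ≃ₗ⁅ℝ⁆ L) : LinearMap.BilinForm ℝ L :=
  -(killingForm ℝ L).compl₂ (θ : L →ₗ⁅ℝ⁆ L).toLinearMap

lemma cartanForm_apply (x y : L) : cartanForm θ x y = -killingForm ℝ L x (θ y) := rfl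

lemma cartanForm_comm (h : IsCartanInvolution θ) (x y : L) :
    cartanForm θ x y = cartanForm θ y x := by
  rw [cartanForm_apply, cartanForm_apply, ← LieAlgebra.killingForm_of_equiv_apply θ x, h.1,
    LieModule.traceForm_comm]

lemma cartanForm_lie {z : L} (hz : θ z = -z) (x y : L) :
    cartanForm θ ⁅z, x⁆ y = cartanForm θ x ⁅z, y⁆ := by
  rw [cartanForm_apply, cartanForm_apply, LieModule.traceForm_apply_lie_apply', θ.map_lie, hz,
    neg_lie, map_neg]

/-- An abelian subspace as a Lie subalgebra. -/
def IsMaxAbelianInP.lieSubalgebra (h : IsMaxAbelianInP θ a) : LieSubalgebra ℝ L where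
  __ := a
  lie_mem' {x y} hx hy := by
    rw [h.2.1 x hx y hy]
    exact a.zero_mem

lemma IsMaxAbelianInP.isCartanSubalgebra (hθ : IsCartanInvolution θ) (h : IsMaxAbelianInP θ a)
    (hsplit : {x : L | ∀ y ∈ a, ⁅x, y⁆ = 0} = (a : Set L)) :
    h.lieSubalgebra.IsCartanSubalgebra where
  nilpotent := by
    have : IsLieAbelian h.lieSubalgebra := ⟨fun x y ↦ Subtype.ext (h.2.1 x x.2 y y.2)⟩
    infer_instance
  self_normalizing := by
    refine le_antisymm (fun x hx ↦ ?_) (LieSubalgebra.le_normalizer _)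
    rw [LieSubalgebra.mem_normalizer_iff'] at hx
    change x ∈ (a : Set L)
    rw [← hsplit]
    intro y hy
    rw [← lie_skew, neg_eq_zero]
    by_contra hne
    have h₁ := hθ.2 _ hne
    rw [← cartanForm_apply, cartanForm_lie (h.1 y hy), h.2.1 y hy _ (hx y hy), map_zero] at h₁
    exact h₁.false

lemma IsMaxAbelianInP.isTriangularizable [FiniteDimensional ℝ L] (hθ : IsCartanInvolution θ)
    (h : IsMaxAbelianInP θ a) : IsTriangularizable ℝ h.lieSubalgebra L where
  maxGenEigenspace_eq_top x := by
    have hx (y z : L) : cartanForm θ (toEnd ℝ h.lieSubalgebra L x y) z =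
        cartanForm θ y (toEnd ℝ h.lieSubalgebra L x z) := cartanForm_lie (h.1 x x.2) y z
    have key := LinearMap.BilinForm.iSup_eigenspace_eq_top (cartanForm θ) (cartanForm_comm hθ)
      hθ.2 _ hx
    rw [eq_top_iff, ← key]
    exact iSup_mono fun μ ↦ Module.End.genEigenspace_le_maximal _ μ 1

lemma exists_base_iwasawaNilpart_eq_posPart [FiniteDimensional ℝ L] [LieAlgebra.IsKilling ℝ L]
    (hθ : IsCartanInvolution θ) (h : IsMaxAbelianInP θ a)
    (hsplit : {x : L | ∀ y ∈ a, ⁅x, y⁆ = 0} = (a : Set L)) (H₀ : a) (hH₀ : IsRegularElt a H₀) :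
    ∃ (H : LieSubalgebra ℝ L) (_ : H.IsCartanSubalgebra) (_ : IsTriangularizable ℝ H L)
      (b : (rootSystem H).Base), iwasawaNilpart a H₀ = posPart b := by
  have hC := h.isCartanSubalgebra hθ hsplit
  have hT := h.isTriangularizable hθ
  set H := h.lieSubalgebra with hH
  let e : a ≃ₗ[ℝ] H := LinearEquiv.refl ℝ a
  have hroot (α : H.root) :
      (Weight.toLinear ℝ H L α ∘ₗ e.toLinearMap) ∈ restrictedRoots a ∧
      (LieAlgebra.rootSpace H (α : Weight ℝ H L)).toSubmodule ≤
        restrictedRootSpace a (Weight.toLinear ℝ H L α ∘ₗ e.toLinearMap) := by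
    have hle : (LieAlgebra.rootSpace H (α : Weight ℝ H L)).toSubmodule ≤
        restrictedRootSpace a (Weight.toLinear ℝ H L α ∘ₗ e.toLinearMap) :=
      fun x hx y ↦ lie_coe_of_mem_rootSpace hx (e y)
    refine ⟨⟨fun h0 ↦ H.isNonZero_coe_root α ?_, fun h0 ↦ ?_⟩, hle⟩
    · ext y
      exact LinearMap.congr_fun h0 (e.symm y)
    · rw [h0, le_bot_iff, LieSubmodule.toSubmodule_eq_bot] at hle
      exact (α : Weight ℝ H L).genWeightSpace_ne_bot' hle
  obtain ⟨b, hb⟩ := exists_base_forall_isPos_iff (e H₀) fun α ↦ hH₀ _ (hroot α).1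
  refine ⟨H, hC, hT, b, le_antisymm (iSup₂_le fun l hl ↦ ?_) (iSup_le fun α ↦ ?_)⟩
  · have hle : restrictedRootSpace a l ≤
        (LieAlgebra.rootSpace H (l ∘ₗ e.symm.toLinearMap)).toSubmodule := by
      refine le_trans ?_ (weightSpace_le_genWeightSpace L _)
      intro x hx
      rw [LieSubmodule.mem_toSubmodule, mem_weightSpace]
      exact fun y ↦ hx (e.symm y)
    let w : Weight ℝ H L := ⟨l ∘ₗ e.symm.toLinearMap, fun h0 ↦ hl.1.2 <| by
      rwa [LieAlgebra.rootSpace, h0, LieSubmodule.bot_toSubmodule, le_bot_iff] at hle⟩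
    have hw : w.IsNonZero := fun h0 ↦ hl.1.1 <| by
      ext y
      exact congr_fun h0 (e y)
    let α : H.root := ⟨w, by simpa using hw⟩
    exact hle.trans (le_iSup (fun α : {α : H.root // b.IsPos α} ↦
      (LieAlgebra.rootSpace H (α.1 : Weight ℝ H L)).toSubmodule) ⟨α, (hb α).2 hl.2⟩)
  · exact (hroot α.1).2.trans (le_iSup₂_of_le _ ⟨(hroot α.1).1, (hb α.1).1 α.2⟩ le_rfl)

end

/-- **Split real semisimple Lie algebras are determined by the nilpotent Iwasawa part.**
If two finite-dimensional split real semisimple Lie algebras (the centralizer of the maximal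
abelian subspace `𝔞ᵢ ⊆ 𝔭ᵢ` equals `𝔞ᵢ`) have isomorphic nilpotent Iwasawa parts
`𝔫ᵢ = ⊕_{λ ∈ Σᵢ⁺} (𝔤ᵢ)_λ`, then they are isomorphic. -/
theorem split_semisimple_determined_by_nilpotent_iwasawa
    {g₁ g₂ : Type*} [LieRing g₁] [LieAlgebra ℝ g₁] [LieRing g₂] [LieAlgebra ℝ g₂]
    [Module.Finite ℝ g₁] [Module.Finite ℝ g₂]
    [LieAlgebra.IsKilling ℝ g₁] [LieAlgebra.IsKilling ℝ g₂]
    (θ₁ : g₁ ≃ₗ⁅ℝ⁆ g₁) (θ₂ : g₂ ≃ₗ⁅ℝ⁆ g₂)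
    (hθ₁ : IsCartanInvolution θ₁) (hθ₂ : IsCartanInvolution θ₂)
    (a₁ : Submodule ℝ g₁) (a₂ : Submodule ℝ g₂)
    (ha₁ : IsMaxAbelianInP θ₁ a₁) (ha₂ : IsMaxAbelianInP θ₂ a₂)
    (hsplit₁ : {X : g₁ | ∀ H ∈ a₁, ⁅X, H⁆ = 0} = (a₁ : Set g₁))
    (hsplit₂ : {X : g₂ | ∀ H ∈ a₂, ⁅X, H⁆ = 0} = (a₂ : Set g₂))
    (H₁ : a₁) (H₂ : a₂) (hH₁ : IsRegularElt a₁ H₁) (hH₂ : IsRegularElt a₂ H₂)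
    (n₁ : LieSubalgebra ℝ g₁) (hn₁ : (n₁ : Submodule ℝ g₁) = iwasawaNilpart a₁ H₁)
    (n₂ : LieSubalgebra ℝ g₂) (hn₂ : (n₂ : Submodule ℝ g₂) = iwasawaNilpart a₂ H₂)
    (h : Nonempty (n₁ ≃ₗ⁅ℝ⁆ n₂)) : Nonempty (g₁ ≃ₗ⁅ℝ⁆ g₂) := by
  obtain ⟨_, _, _, b₁, hb₁⟩ := exists_base_iwasawaNilpart_eq_posPart hθ₁ ha₁ hsplit₁ H₁ hH₁
  obtain ⟨_, _, _, b₂, hb₂⟩ := exists_base_iwasawaNilpart_eq_posPart hθ₂ ha₂ hsplit₂ H₂ hH₂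
  obtain ⟨φ⟩ := h
  exact LieAlgebra.IsKilling.nonempty_equiv_of_posPart (hn₁.trans hb₁) (hn₂.trans hb₂) φ
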